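/- For every finite simple matroid M and every automorphism g ∈ G, the rule x_{F₁}^{m₁}⋯x_{F_ℓ}^{m_ℓ} ↦ x_{g(F₁)}^{m₁}⋯x_{g(F_ℓ)}^{m_ℓ} sends FY-monomials to FY-monomials of the same degree, so G acts on each set FY^k by permutations; moreover the ℤ-linear isomorphism from the free ℤ-module ℤ[FY^k] on the set FY^k to A^k sending each FY-monomial to its image in A(M) is G-equivariant, so A^k is isomorphic as a ℤG-module to the permutation module ℤ[FY^k]. -/

import Mathlib

open Finset

/-- A finite simple matroid, presented by its lattice of flats and rank function. -/
structure SimpleFlatMatroid (E : Type*) [Fintype E] [DecidableEq E] where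
  /-- the collection of flats -/
  flats : Finset (Finset E)
  /-- the rank function -/
  rk : Finset E → ℕ
  /-- (F1): the ground set is a flat -/
  ground_mem : (Finset.univ : Finset E) ∈ flats
  /-- (F2): flats are closed under intersection -/
  inter_mem : ∀ F ∈ flats, ∀ F' ∈ flats, F ∩ F' ∈ flats
  /-- (F3): for a flat `F` and `i ∉ F` there is a unique flat containing `i` covering `F` -/
  cover_axiom : ∀ F ∈ flats, ∀ i : E, i ∉ F →
    ∃! F' : Finset E, F' ∈ flats ∧ i ∈ F' ∧ F ⊂ F' ∧
      ¬ ∃ F'' ∈ flats, F ⊂ F'' ∧ F'' ⊂ F'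
  /-- simplicity: no loops, i.e. `∅` is a flat -/
  empty_mem : (∅ : Finset E) ∈ flats
  /-- simplicity: no parallel elements, i.e. all singletons are flats -/
  singleton_mem : ∀ i : E, ({i} : Finset E) ∈ flats
  /-- normalization of the rank function -/
  rk_empty : rk ∅ = 0
  /-- the rank function increases by one along covers of flats -/
  rk_cover : ∀ F ∈ flats, ∀ F' ∈ flats, F ⊂ F' →
    (¬ ∃ F'' ∈ flats, F ⊂ F'' ∧ F'' ⊂ F') → rk F' = rk F + 1

namespace SimpleFlatMatroid

variable {E : Type*} [Fintype E] [DecidableEq E]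

/-- We encode a (squarefree-or-not) monomial in the variables `x_F` as the function
sending each `F` to the exponent of `x_F`.  `prevFlat m F` is the union of all flats
in the support of `m` strictly contained in `F`; when the support of `m` is a chain
this is the predecessor of `F` in the support (or `∅` if there is none). -/
def prevFlat (m : Finset E → ℕ) (F : Finset E) : Finset E :=
  Finset.univ.sup fun F' => if m F' ≠ 0 ∧ F' ⊂ F then F' else ∅

/-- The total degree of a monomial. -/
def deg (m : Finset E → ℕ) : ℕ := ∑ F : Finset E, m F

variable (M : SimpleFlatMatroid E)

/-- `m` is an FY-monomial: its support is a chain `F₁ ⊊ ⋯ ⊊ F_ℓ` of nonempty flats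
with `m Fᵢ ≤ rk(Fᵢ) - rk(Fᵢ₋₁) - 1` for all `i` (with `F₀ := ∅`). -/
def IsFY (m : Finset E → ℕ) : Prop :=
  (∀ F : Finset E, m F ≠ 0 → F ∈ M.flats ∧ F ≠ ∅) ∧
  (∀ F F' : Finset E, m F ≠ 0 → m F' ≠ 0 → F ⊆ F' ∨ F' ⊆ F) ∧
  (∀ F : Finset E, m F ≠ 0 → m F + M.rk (prevFlat m F) + 1 ≤ M.rk F)

/-- The set `FY^k` of FY-monomials of total degree `k`, as a type. -/
abbrev FYk (k : ℕ) : Type _ := {m : Finset E → ℕ // M.IsFY m ∧ deg m = k}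

/-- `g` is an automorphism of the matroid: a permutation of the ground set carrying
flats to flats. -/
def IsAut (g : Equiv.Perm E) : Prop := ∀ F ∈ M.flats, F.image g ∈ M.flats

/-- The action of a permutation `g` on monomials:
`g ⋅ (x_{F₁}^{m₁} ⋯ x_{F_ℓ}^{m_ℓ}) = x_{g F₁}^{m₁} ⋯ x_{g F_ℓ}^{m_ℓ}`. -/
def mact (g : Equiv.Perm E) (m : Finset E → ℕ) : Finset E → ℕ :=
  fun F => m (F.image (g⁻¹ : Equiv.Perm E))

end SimpleFlatMatroid

namespace SimpleFlatMatroid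

variable {E : Type*} [Fintype E] [DecidableEq E] (M : SimpleFlatMatroid E)

/-- The index type of the variables of the Chow ring: nonempty flats of `M`. -/
abbrev FlatVar : Type _ := {F : Finset E // F ∈ M.flats ∧ F ≠ ∅}

/-- The polynomial ring `S = ℤ[x_F : ∅ ≠ F ∈ 𝓕]`. -/
abbrev ChowPoly : Type _ := MvPolynomial (FlatVar M) ℤ

/-- The ideal `I + J`, where `I` is generated by the products `x_F x_{F'}` over
incomparable pairs of nonempty flats, and `J` is generated by the linear forms
`∑_{F ∋ a} x_F`, one for each element `a` of the ground set. -/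
noncomputable def chowIdeal : Ideal (ChowPoly M) :=
  Ideal.span
    ({p | ∃ F F' : FlatVar M, ¬ F.1 ⊆ F'.1 ∧ ¬ F'.1 ⊆ F.1 ∧
        p = MvPolynomial.X F * MvPolynomial.X F'} ∪
     {p | ∃ a : E, p = ∑ F : FlatVar M, if a ∈ F.1 then MvPolynomial.X F else 0})

/-- The Chow ring `A(M) = S/(I+J)`. -/
abbrev ChowRing : Type _ := ChowPoly M ⧸ chowIdeal M

/-- The quotient map `S → A(M)`. -/
noncomputable def chowMk : ChowPoly M →ₐ[ℤ] ChowRing M :=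
  Ideal.Quotient.mkₐ ℤ (chowIdeal M)

/-- The degree-`k` graded component `A^k` of the Chow ring, i.e. the image of the
homogeneous degree-`k` polynomials under the quotient map. -/
noncomputable def chowComp (k : ℕ) : Submodule ℤ (ChowRing M) :=
  (MvPolynomial.homogeneousSubmodule (FlatVar M) ℤ k).map (chowMk M).toLinearMap

/-- The polynomial `x_{F₁}^{m₁} ⋯ x_{F_ℓ}^{m_ℓ}` in `S` corresponding to a monomial
given as an exponent function on flats. -/
noncomputable def FYpoly (m : Finset E → ℕ) : ChowPoly M :=
  MvPolynomial.monomial (Finsupp.equivFunOnFinite.symm fun F : FlatVar M => m F.1) 1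

/-- The action of an automorphism `g` on the polynomial ring `S`, by `x_F ↦ x_{g F}`. -/
noncomputable def autRename (g : Equiv.Perm E) (hg : M.IsAut g) :
    ChowPoly M →ₐ[ℤ] ChowPoly M :=
  MvPolynomial.rename fun F : FlatVar M =>
    (⟨F.1.image g, hg F.1 F.2.1, by
        simpa [Finset.image_eq_empty] using F.2.2⟩ : FlatVar M)

/-- The class in `A^k` of a homogeneous polynomial of degree `k`. -/
noncomputable def clsOf {k : ℕ} (p : ChowPoly M)
    (hp : p ∈ MvPolynomial.homogeneousSubmodule (FlatVar M) ℤ k) : chowComp M k :=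
  ⟨chowMk M p, Submodule.mem_map_of_mem hp⟩


/-- The variable `x_E` corresponding to the ground set. -/
noncomputable def xE [Nonempty E] : ChowPoly M :=
  MvPolynomial.X (⟨Finset.univ, M.ground_mem, Finset.univ_nonempty.ne_empty⟩ : FlatVar M)

end SimpleFlatMatroid


namespace SimpleFlatMatroid

section basics
variable {E : Type*} [Fintype E] [DecidableEq E] (M : SimpleFlatMatroid E)

/-- The closure of `F ∪ {a}`. -/
theorem exists_join (F : Finset E) (hF : F ∈ M.flats) (a : E) (ha : a ∉ F) :
    ∃ L ∈ M.flats, a ∈ L ∧ F ⊂ L ∧ M.rk L = M.rk F + 1 ∧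
      (∀ G ∈ M.flats, F ⊆ G → a ∈ G → L ⊆ G) := by
  obtain ⟨L, ⟨hL, haL, hFL, hcov⟩, -⟩ := cover_axiom M F hF a ha
  refine ⟨L, hL, haL, hFL, M.rk_cover F hF L hL hFL hcov, ?_⟩
  intro G hG hFG haG
  by_contra hLG
  apply hcov
  refine ⟨L ∩ G, M.inter_mem L hL G hG, ?_, ?_⟩
  · refine ⟨Finset.subset_inter hFL.1 hFG, fun h => ha (h (by simp [haL, haG]))⟩
  · refine ⟨Finset.inter_subset_left, fun h => hLG (fun x hx => (Finset.mem_inter.1 (h hx)).2)⟩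

/-- Rank is strictly increasing, and there is a spanning set of size the rank difference. -/
theorem exists_span (n : ℕ) : ∀ (F G : Finset E), F ∈ M.flats → G ∈ M.flats → F ⊆ G →
    (G \ F).card = n → M.rk F ≤ M.rk G ∧ (F ≠ G → M.rk F < M.rk G) ∧
    ∃ S : Finset E, S ⊆ G \ F ∧ S.card + M.rk F = M.rk G ∧
      ∀ H ∈ M.flats, F ⊆ H → S ⊆ H → G ⊆ H := by
  induction n using Nat.strong_induction_on with
  | _ n ih =>
    intro F G hF hG hFG hn
    by_cases hEq : F = G
    · subst hEq
      exact ⟨le_rfl, fun h => (h rfl).elim, ∅, by simp, by simp, fun H _ h _ => h⟩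
    · have hss : F ⊂ G := lt_of_le_of_ne hFG hEq
      obtain ⟨a, haG, haF⟩ := Finset.exists_of_ssubset hss
      obtain ⟨L, hL, haL, hFL, hrk, hmin⟩ := M.exists_join F hF a haF
      have hLG := hmin G hG hFG haG
      have hlt : (G \ L).card < n := by
        rw [← hn]
        apply Finset.card_lt_card
        refine ⟨Finset.sdiff_subset_sdiff le_rfl hFL.1, fun h => ?_⟩
        have := h (Finset.mem_sdiff.2 ⟨haG, haF⟩)
        exact (Finset.mem_sdiff.1 this).2 haL
      obtain ⟨h1, h2, S, hS, hc, hsp⟩ := ih _ hlt L G hL hG hLG rfl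
      refine ⟨by omega, fun _ => by omega, insert a S, ?_, ?_, ?_⟩
      · intro x hx
        rcases Finset.mem_insert.1 hx with rfl | hx
        · simp [haG, haF]
        · have := Finset.mem_sdiff.1 (hS hx)
          exact Finset.mem_sdiff.2 ⟨this.1, fun h => this.2 (hFL.1 h)⟩
      · rw [Finset.card_insert_of_notMem]
        · omega
        · intro h
          exact (Finset.mem_sdiff.1 (hS h)).2 haL
      · intro H hH hFH hSH
        have hLH := hmin H hH hFH (hSH (Finset.mem_insert_self _ _))
        exact hsp H hH hLH (fun x hx => hSH (Finset.mem_insert_of_mem hx))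

theorem rk_mono {F G : Finset E} (hF : F ∈ M.flats) (hG : G ∈ M.flats) (h : F ⊆ G) :
    M.rk F ≤ M.rk G := (M.exists_span _ F G hF hG h rfl).1

theorem rk_lt {F G : Finset E} (hF : F ∈ M.flats) (hG : G ∈ M.flats) (h : F ⊂ G) :
    M.rk F < M.rk G := (M.exists_span _ F G hF hG h.1 rfl).2.1 h.ne

theorem eq_of_rk {F G : Finset E} (hF : F ∈ M.flats) (hG : G ∈ M.flats) (h : F ⊆ G)
    (hr : M.rk G ≤ M.rk F) : F = G := by
  by_contra hne
  have := M.rk_lt hF hG (lt_of_le_of_ne h hne)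
  omega

/-- Moebius function of the lattice of flats. -/
noncomputable def mu (F H : Finset E) : ℤ :=
  if F = H then 1 else
    - ∑ K ∈ (M.flats.filter (fun K => F ⊆ K ∧ K ⊂ H)).attach, mu F K.1
termination_by H.card
decreasing_by
  have := K.2
  simp only [Finset.mem_filter] at this
  exact Finset.card_lt_card this.2.2

theorem mu_self (F : Finset E) : M.mu F F = 1 := by
  rw [mu]; simp

theorem mu_sum {F H : Finset E} (hH : H ∈ M.flats) (hFH : F ⊂ H) :
    ∑ K ∈ M.flats.filter (fun K => F ⊆ K ∧ K ⊆ H), M.mu F K = 0 := by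
  have h1 : M.flats.filter (fun K => F ⊆ K ∧ K ⊆ H) =
      insert H (M.flats.filter (fun K => F ⊆ K ∧ K ⊂ H)) := by
    ext K
    simp only [Finset.mem_filter, Finset.mem_insert]
    constructor
    · rintro ⟨h1, h2, h3⟩
      by_cases h : K = H
      · exact Or.inl h
      · exact Or.inr ⟨h1, h2, lt_of_le_of_ne h3 h⟩
    · rintro (rfl | ⟨h1, h2, h3⟩)
      · exact ⟨hH, hFH.1, le_rfl⟩
      · exact ⟨h1, h2, h3.1⟩
  rw [h1, Finset.sum_insert (by simp)]
  rw [mu, if_neg hFH.ne]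
  rw [Finset.sum_attach (M.flats.filter (fun K => F ⊆ K ∧ K ⊂ H)) (fun K => M.mu F K)]
  ring

/-- closure of `K ∪ {a}` as the intersection of the flats containing it. -/
def join (K : Finset E) (a : E) : Finset E :=
  (M.flats.filter (fun L => K ⊆ L ∧ a ∈ L)).inf id

theorem join_eq_of_mem {K : Finset E} (hK : K ∈ M.flats) {a : E} (ha : a ∈ K) :
    M.join K a = K := by
  apply le_antisymm
  · exact Finset.inf_le (f := id) (by simp [hK, ha])
  · refine Finset.le_inf fun L hL => ?_
    exact (Finset.mem_filter.1 hL).2.1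

theorem join_spec {K : Finset E} (hK : K ∈ M.flats) {a : E} (ha : a ∉ K) :
    M.join K a ∈ M.flats ∧ a ∈ M.join K a ∧ K ⊂ M.join K a ∧
      M.rk (M.join K a) = M.rk K + 1 := by
  obtain ⟨L, hL, haL, hFL, hrk, hmin⟩ := M.exists_join K hK a ha
  have : M.join K a = L := by
    apply le_antisymm
    · exact Finset.inf_le (f := id) (by simp [hL, haL, hFL.1])
    · refine Finset.le_inf fun L' hL' => ?_
      have := Finset.mem_filter.1 hL'
      exact hmin _ this.1 this.2.1 this.2.2
  rw [this]
  exact ⟨hL, haL, hFL, hrk⟩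

theorem join_le {K G : Finset E} (hG : G ∈ M.flats) (h : K ⊆ G) {a : E} (ha : a ∈ G) :
    M.join K a ⊆ G := Finset.inf_le (f := id) (by simp [hG, ha, h])

theorem join_mem {K : Finset E} (hK : K ∈ M.flats) (a : E) : M.join K a ∈ M.flats := by
  by_cases ha : a ∈ K
  · rwa [M.join_eq_of_mem hK ha]
  · exact (M.join_spec hK ha).1

theorem mem_join {K : Finset E} (hK : K ∈ M.flats) (a : E) : a ∈ M.join K a := by
  by_cases ha : a ∈ K
  · rwa [M.join_eq_of_mem hK ha]
  · exact (M.join_spec hK ha).2.1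

theorem subset_join {K : Finset E} (hK : K ∈ M.flats) (a : E) : K ⊆ M.join K a := by
  by_cases ha : a ∈ K
  · rw [M.join_eq_of_mem hK ha]
  · exact (M.join_spec hK ha).2.2.1.1

theorem weisner {F : Finset E} {a : E} (ha : a ∉ F) (n : ℕ) :
    ∀ H ∈ M.flats, F ⊆ H → a ∈ H → H.card = n →
    ∑ K ∈ M.flats.filter (fun K => F ⊆ K ∧ M.join K a = H), M.mu F K = 0 := by
  induction n using Nat.strong_induction_on with
  | _ n ih =>
    intro H hH hFH haH hn
    have hss : F ⊂ H := ⟨hFH, fun h => ha (h haH)⟩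
    have h0 := M.mu_sum hH hss
    have hmaps : ∀ K ∈ M.flats.filter (fun K => F ⊆ K ∧ K ⊆ H),
        M.join K a ∈ M.flats.filter (fun L => F ⊆ L ∧ L ⊆ H ∧ a ∈ L) := by
      intro K hK
      obtain ⟨h1, h2, h3⟩ := Finset.mem_filter.1 hK
      refine Finset.mem_filter.2 ⟨M.join_mem h1 a, h2.trans (M.subset_join h1 a),
        M.join_le hH h3 haH, M.mem_join h1 a⟩
    rw [← Finset.sum_fiberwise_of_maps_to hmaps] at h0
    have hHm : H ∈ M.flats.filter (fun L => F ⊆ L ∧ L ⊆ H ∧ a ∈ L) := by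
      simp [hH, hFH, haH]
    rw [Finset.sum_eq_single_of_mem H hHm] at h0
    · rw [← h0]
      apply Finset.sum_congr _ (fun _ _ => rfl)
      ext K
      simp only [Finset.mem_filter]
      constructor
      · rintro ⟨h1, h2, h3⟩
        exact ⟨⟨h1, h2, h3 ▸ M.subset_join h1 a⟩, h3⟩
      · rintro ⟨⟨h1, h2, h3⟩, h4⟩
        exact ⟨h1, h2, h4⟩
    · intro L hL hne
      obtain ⟨h1, h2, h3, h4⟩ := Finset.mem_filter.1 hL
      have hLH : L ⊂ H := lt_of_le_of_ne h3 hne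
      have := ih L.card (hn ▸ Finset.card_lt_card hLH) L h1 h2 h4 rfl
      rw [← this]
      apply Finset.sum_congr _ (fun _ _ => rfl)
      ext K
      simp only [Finset.mem_filter]
      constructor
      · rintro ⟨⟨h1, h2, h3⟩, h4⟩
        exact ⟨h1, h2, h4⟩
      · rintro ⟨h1, h2, h3⟩
        exact ⟨⟨h1, h2, (M.subset_join h1 a).trans (h3 ▸ hLH.1)⟩, h3⟩

/-- partial sums of the Moebius function. -/
noncomputable def U (F G : Finset E) (t : ℕ) : ℤ :=
  ∑ K ∈ M.flats.filter (fun K => (F ⊆ K ∧ K ⊆ G) ∧ M.rk K ≤ t), M.mu F K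

theorem U_lt {F G : Finset E} (hF : F ∈ M.flats) {t : ℕ} (h : t < M.rk F) : M.U F G t = 0 := by
  apply Finset.sum_eq_zero
  intro K hK
  obtain ⟨h1, ⟨h2, _⟩, h3⟩ := Finset.mem_filter.1 hK
  have := M.rk_mono hF h1 h2
  omega

theorem U_rk {F G : Finset E} (hF : F ∈ M.flats) (hFG : F ⊆ G) : M.U F G (M.rk F) = 1 := by
  have : M.flats.filter (fun K => (F ⊆ K ∧ K ⊆ G) ∧ M.rk K ≤ M.rk F) = {F} := by
    ext K
    simp only [Finset.mem_filter, Finset.mem_singleton]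
    constructor
    · rintro ⟨h1, ⟨h2, h3⟩, h4⟩
      exact (M.eq_of_rk hF h1 h2 h4).symm
    · rintro rfl
      exact ⟨hF, ⟨le_rfl, hFG⟩, le_rfl⟩
  rw [U, this, Finset.sum_singleton, mu_self]

theorem U_top {F H : Finset E} (hH : H ∈ M.flats) (hFH : F ⊂ H) {t : ℕ}
    (ht : M.rk H = t + 1) : M.U F H t = - M.mu F H := by
  have h0 := M.mu_sum hH hFH
  have h1 : M.flats.filter (fun K => F ⊆ K ∧ K ⊆ H) =
      insert H (M.flats.filter (fun K => (F ⊆ K ∧ K ⊆ H) ∧ M.rk K ≤ t)) := by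
    ext K
    simp only [Finset.mem_filter, Finset.mem_insert]
    constructor
    · rintro ⟨h1, h2, h3⟩
      by_cases h : K = H
      · exact Or.inl h
      · refine Or.inr ⟨h1, ⟨h2, h3⟩, ?_⟩
        have := M.rk_lt h1 hH (lt_of_le_of_ne h3 h)
        omega
    · rintro (rfl | ⟨h1, ⟨h2, h3⟩, h4⟩)
      · exact ⟨hH, hFH.1, le_rfl⟩
      · exact ⟨h1, h2, h3⟩
  rw [h1, Finset.sum_insert (by simp [ht])] at h0
  rw [U]; linarith

theorem U_succ (F G : Finset E) (t : ℕ) :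
    ∑ H ∈ M.flats.filter (fun H => (F ⊆ H ∧ H ⊆ G) ∧ M.rk H = t + 1), M.mu F H
      = M.U F G (t+1) - M.U F G t := by
  have h1 : M.flats.filter (fun K => (F ⊆ K ∧ K ⊆ G) ∧ M.rk K ≤ t + 1) =
      (M.flats.filter (fun H => (F ⊆ H ∧ H ⊆ G) ∧ M.rk H = t + 1)) ∪
      (M.flats.filter (fun K => (F ⊆ K ∧ K ⊆ G) ∧ M.rk K ≤ t)) := by
    ext K
    simp only [Finset.mem_filter, Finset.mem_union]
    have : M.rk K ≤ t + 1 ↔ M.rk K = t + 1 ∨ M.rk K ≤ t := by omega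
    tauto
  rw [U, h1, Finset.sum_union, U]
  · ring
  · rw [Finset.disjoint_left]
    intro K h1 h2
    simp only [Finset.mem_filter] at h1 h2
    omega

theorem U_elem {F G : Finset E} (hG : G ∈ M.flats) {a : E} (haF : a ∉ F)
    (haG : a ∈ G) (t : ℕ) :
    ∑ H ∈ M.flats.filter (fun H => (F ⊆ H ∧ H ⊆ G) ∧ M.rk H = t + 1 ∧ a ∈ H), M.mu F H
      = - M.U F G t := by
  set X := M.flats.filter (fun L => (F ⊆ L ∧ L ⊆ G) ∧ M.rk L ≤ t + 1 ∧ a ∈ L) with hX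
  -- the set of all `K` with `rk (K ∨ a) ≤ t + 1`
  set Y := M.flats.filter (fun K => (F ⊆ K ∧ K ⊆ G) ∧ M.rk (M.join K a) ≤ t + 1) with hY
  have hmaps : ∀ K ∈ Y, M.join K a ∈ X := by
    intro K hK
    obtain ⟨h1, ⟨h2, h3⟩, h4⟩ := Finset.mem_filter.1 hK
    exact Finset.mem_filter.2 ⟨M.join_mem h1 a, ⟨h2.trans (M.subset_join h1 a),
      M.join_le hG h3 haG⟩, h4, M.mem_join h1 a⟩
  have h0 : ∑ K ∈ Y, M.mu F K = 0 := by
    rw [← Finset.sum_fiberwise_of_maps_to hmaps]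
    apply Finset.sum_eq_zero
    intro L hL
    obtain ⟨h1, ⟨h2, h3⟩, h4, h5⟩ := Finset.mem_filter.1 hL
    rw [← M.weisner haF L.card L h1 h2 h5 rfl]
    apply Finset.sum_congr _ (fun _ _ => rfl)
    ext K
    simp only [hY, Finset.mem_filter]
    constructor
    · rintro ⟨⟨h1, ⟨h2, _⟩, h3⟩, h4⟩
      exact ⟨h1, h2, h4⟩
    · rintro ⟨h1', h2', h3'⟩
      exact ⟨⟨h1', ⟨h2', (M.subset_join h1' a).trans (h3' ▸ h3)⟩, h3' ▸ h4⟩, h3'⟩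
  have h1 : Y = (M.flats.filter (fun H => (F ⊆ H ∧ H ⊆ G) ∧ M.rk H = t + 1 ∧ a ∈ H)) ∪
      (M.flats.filter (fun K => (F ⊆ K ∧ K ⊆ G) ∧ M.rk K ≤ t)) := by
    ext K
    simp only [hY, Finset.mem_filter, Finset.mem_union]
    by_cases hK : K ∈ M.flats
    · by_cases ha : a ∈ K
      · rw [M.join_eq_of_mem hK ha]
        have : M.rk K ≤ t + 1 ↔ M.rk K = t + 1 ∨ M.rk K ≤ t := by omega
        tauto
      · have := (M.join_spec hK ha).2.2.2
        rw [this]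
        have : M.rk K + 1 ≤ t + 1 ↔ M.rk K ≤ t := by omega
        tauto
    · tauto
  rw [h1, Finset.sum_union] at h0
  · rw [U]; linarith
  · rw [Finset.disjoint_left]
    intro K h1 h2
    simp only [Finset.mem_filter] at h1 h2
    omega

end basics
end SimpleFlatMatroid

namespace SimpleFlatMatroid

section functional
variable {E : Type*} [Fintype E] [DecidableEq E] (M : SimpleFlatMatroid E)

/-- local factor of the degree functional -/
noncomputable def psi (F G : Finset E) (d t : ℕ) : ℤ :=
  -((-1) ^ (t - M.rk F) * ((d - 1).choose (t - M.rk F) : ℤ) * M.U F G t)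

theorem psi_lt {F G : Finset E} (hF : F ∈ M.flats) {d t : ℕ} (h : t < M.rk F) :
    M.psi F G d t = 0 := by
  simp [psi, M.U_lt hF h]

theorem psi_big {F G : Finset E} {d t : ℕ} (hd : 1 ≤ d) (h : M.rk F + d ≤ t) :
    M.psi F G d t = 0 := by
  rw [psi, Nat.choose_eq_zero_of_lt (by omega)]; simp

theorem psi_rk {F G : Finset E} (hF : F ∈ M.flats) (hFG : F ⊆ G) (d : ℕ) :
    M.psi F G d (M.rk F) = -1 := by
  simp [psi, M.U_rk hF hFG]

theorem psi_ins {H G : Finset E} (hH : H ∈ M.flats) (hHG : H ⊆ G) (t : ℕ) :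
    M.psi H G 1 (t + 1) = if M.rk H = t + 1 then -1 else 0 := by
  split_ifs with h
  · rw [← h, M.psi_rk hH hHG]
  · rcases lt_or_gt_of_ne h with h | h
    · exact M.psi_big le_rfl (by omega)
    · exact M.psi_lt hH h

theorem psi_prod {F H G : Finset E} (hH : H ∈ M.flats) (hFH : F ⊂ H)
    (hHG : H ⊆ G) (d t : ℕ) :
    M.psi F H d t * M.psi H G 1 (t + 1) =
     if M.rk H = t + 1 then
      -((-1) ^ (t - M.rk F) * ((d - 1).choose (t - M.rk F) : ℤ)) * M.mu F H else 0 := by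
  rw [M.psi_ins hH hHG]
  split_ifs with h
  · rw [psi, M.U_top hH hFH h]; ring
  · simp

theorem key1 {F G : Finset E} (hF : F ∈ M.flats) (hFG : F ⊂ G) {d t : ℕ}
    (hd : 1 ≤ d) (ht : t + 1 < M.rk G) :
    M.psi F G (d+1) (t+1) +
      ∑ H ∈ M.flats.filter (fun H => F ⊂ H ∧ H ⊂ G), M.psi F H d t * M.psi H G 1 (t+1)
    = M.psi F G d (t+1) - M.psi F G d t := by
  rcases lt_or_ge t (M.rk F) with h | h
  · rw [Finset.sum_eq_zero (fun H _ => by rw [M.psi_lt hF h]; simp), M.psi_lt hF h]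
    rcases lt_or_eq_of_le (Nat.succ_le_of_lt h) with h' | h'
    · rw [M.psi_lt hF h', M.psi_lt hF h']; simp
    · have h'' : t + 1 = M.rk F := h'
      rw [h'', M.psi_rk hF hFG.1, M.psi_rk hF hFG.1]; simp
  · have hs : ∑ H ∈ M.flats.filter (fun H => F ⊂ H ∧ H ⊂ G), M.psi F H d t * M.psi H G 1 (t+1)
       = -((-1) ^ (t - M.rk F) * ((d - 1).choose (t - M.rk F) : ℤ)) *
         (M.U F G (t+1) - M.U F G t) := by
      rw [← M.U_succ F G t, Finset.mul_sum]
      have : M.flats.filter (fun H => (F ⊆ H ∧ H ⊆ G) ∧ M.rk H = t + 1) =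
        (M.flats.filter (fun H => F ⊂ H ∧ H ⊂ G)).filter (fun H => M.rk H = t + 1) := by
        ext H
        simp only [Finset.mem_filter]
        constructor
        · rintro ⟨h1, ⟨h2, h3⟩, h4⟩
          refine ⟨⟨h1, lt_of_le_of_ne h2 ?_, lt_of_le_of_ne h3 ?_⟩, h4⟩
          · rintro rfl; omega
          · rintro rfl; omega
        · rintro ⟨⟨h1, h2, h3⟩, h4⟩
          exact ⟨h1, ⟨h2.1, h3.1⟩, h4⟩
      rw [this, Finset.sum_filter (fun H => M.rk H = t + 1)]
      apply Finset.sum_congr rfl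
      intro H hH
      obtain ⟨h1, h2, h3⟩ := Finset.mem_filter.1 hH
      exact M.psi_prod h1 h2 h3.1 d t
    rw [hs]
    obtain ⟨d, rfl⟩ : ∃ d', d = d' + 1 := ⟨d - 1, by omega⟩
    obtain ⟨s, rfl⟩ : ∃ s, t = M.rk F + s := ⟨t - M.rk F, by omega⟩
    simp only [psi]
    have e1 : M.rk F + s + 1 - M.rk F = s + 1 := by omega
    have e2 : M.rk F + s - M.rk F = s := by omega
    rw [e1, e2]
    simp only [Nat.add_sub_cancel, Nat.choose_succ_succ d s]
    push_cast
    ring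

theorem key2 {F G : Finset E} (hF : F ∈ M.flats) (hG : G ∈ M.flats)
    {d t : ℕ} {a : E} (haF : a ∉ F) (haG : a ∈ G)
    (ht : t + 1 < M.rk G) :
      ∑ H ∈ M.flats.filter (fun H => (F ⊂ H ∧ H ⊂ G) ∧ a ∈ H),
        M.psi F H d t * M.psi H G 1 (t+1)
    = - M.psi F G d t := by
  rcases lt_or_ge t (M.rk F) with h | h
  · rw [Finset.sum_eq_zero (fun H _ => by rw [M.psi_lt hF h]; simp), M.psi_lt hF h]; simp
  · have hs : ∑ H ∈ M.flats.filter (fun H => (F ⊂ H ∧ H ⊂ G) ∧ a ∈ H),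
        M.psi F H d t * M.psi H G 1 (t+1)
       = -((-1) ^ (t - M.rk F) * ((d - 1).choose (t - M.rk F) : ℤ)) *
         (- M.U F G t) := by
      rw [← M.U_elem hG haF haG t, Finset.mul_sum]
      have : M.flats.filter (fun H => (F ⊆ H ∧ H ⊆ G) ∧ M.rk H = t + 1 ∧ a ∈ H) =
        (M.flats.filter (fun H => (F ⊂ H ∧ H ⊂ G) ∧ a ∈ H)).filter
          (fun H => M.rk H = t + 1) := by
        ext H
        simp only [Finset.mem_filter]
        constructor
        · rintro ⟨h1, ⟨h2, h3⟩, h4, h5⟩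
          refine ⟨⟨h1, ⟨lt_of_le_of_ne h2 ?_, lt_of_le_of_ne h3 ?_⟩, h5⟩, h4⟩
          · rintro rfl; omega
          · rintro rfl; omega
        · rintro ⟨⟨h1, ⟨h2, h3⟩, h5⟩, h4⟩
          exact ⟨h1, ⟨h2.1, h3.1⟩, h4, h5⟩
      rw [this, Finset.sum_filter (fun H => M.rk H = t + 1)]
      apply Finset.sum_congr rfl
      intro H hH
      obtain ⟨h1, ⟨h2, h3⟩, h4⟩ := Finset.mem_filter.1 hH
      exact M.psi_prod h1 h2 h3.1 d t
    rw [hs, psi]; ring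

/-- The degree functional, computed by walking through a list of flats. -/
noncomputable def V (m : Finset E → ℕ) : List (Finset E) → Finset E → ℕ → ℕ → ℤ
  | [], F, d, t => M.psi F Finset.univ d t
  | G :: l, F, d, t =>
    if m G = 0 then V m l F d t
    else if F ⊂ G then M.psi F G d t * V m l G (m G) (t + m G) else 0

theorem V_congr {m m' : Finset E → ℕ} : ∀ (l : List (Finset E)) (F : Finset E) (d t : ℕ),
    (∀ G ∈ l, m G = m' G) → M.V m l F d t = M.V m' l F d t
  | [], F, d, t, _ => rfl
  | G :: l, F, d, t, h => by
    have hG : m G = m' G := h G (by simp)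
    have hl : ∀ K ∈ l, m K = m' K := fun K hK => h K (by simp [hK])
    rw [V, V, hG, V_congr l F d t hl, V_congr l G (m' G) (t + m' G) hl]

theorem V_big (m : Finset E → ℕ) : ∀ (l : List (Finset E)) (F : Finset E) (d t : ℕ),
    1 ≤ d → M.rk F + d ≤ t → M.V m l F d t = 0
  | [], F, d, t, h1, h2 => M.psi_big h1 h2
  | G :: l, F, d, t, h1, h2 => by
    rw [V, V_big m l F d t h1 h2, M.psi_big h1 h2]; simp

/-- add one to the exponent of `x_H` -/
def bump (m : Finset E → ℕ) (H : Finset E) : Finset E → ℕ :=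
  fun K => m K + if K = H then 1 else 0

/-- `pre ++ l` is a linear extension of the proper nonempty flats -/
structure Good (pre l : List (Finset E)) : Prop where
  nodup : (pre ++ l).Nodup
  mem : ∀ H, H ∈ pre ++ l ↔ H ∈ M.flats ∧ H ≠ ∅ ∧ H ≠ Finset.univ
  sorted : (pre ++ l).Pairwise (fun A B => ¬ B ⊂ A)

variable {M}

theorem Good.shift {pre l : List (Finset E)} {G : Finset E} (h : M.Good pre (G :: l)) :
    M.Good (pre ++ [G]) l := by
  have : pre ++ [G] ++ l = pre ++ G :: l := by simp
  exact ⟨this ▸ h.nodup, this ▸ h.mem, this ▸ h.sorted⟩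

theorem Good.notMem {pre l : List (Finset E)} {G : Finset E} (h : M.Good pre (G :: l)) :
    G ∉ l := by
  have := h.nodup
  rw [List.nodup_append] at this
  exact (List.nodup_cons.1 this.2.1).1

theorem Good.flat {pre l : List (Finset E)} {G : Finset E} (h : M.Good pre (G :: l)) :
    G ∈ M.flats ∧ G ≠ ∅ ∧ G ≠ Finset.univ := (h.mem G).1 (by simp)

theorem Good.pre_not {pre l : List (Finset E)} {G : Finset E} (h : M.Good pre (G :: l)) :
    ∀ H ∈ pre ++ [G], ¬ G ⊂ H := by
  intro H hH
  rcases List.mem_append.1 hH with hH | hH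
  · have := (List.pairwise_append.1 h.sorted).2.2 H hH G (by simp)
    exact this
  · simp at hH; subst hH; exact fun h => h.ne rfl

theorem Good.between {pre l : List (Finset E)} {F G : Finset E} (h : M.Good pre (G :: l))
    (P : Finset E → Prop) [DecidablePred P] (f : Finset E → ℤ) :
    (pre.map (fun H => if (F ⊂ H ∧ H ⊂ G) ∧ P H then f H else 0)).sum =
     ∑ H ∈ M.flats.filter (fun H => (F ⊂ H ∧ H ⊂ G) ∧ P H), f H := by
  have hnd : pre.Nodup := (List.nodup_append.1 h.nodup).1
  rw [← List.sum_toFinset _ hnd, ← Finset.sum_filter]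
  apply Finset.sum_congr _ (fun _ _ => rfl)
  ext H
  simp only [Finset.mem_filter, List.mem_toFinset]
  constructor
  · rintro ⟨h1, h2⟩
    exact ⟨((h.mem H).1 (by simp [h1])).1, h2⟩
  · rintro ⟨h1, h2⟩
    refine ⟨?_, h2⟩
    have hm : H ∈ pre ++ G :: l := by
      rw [h.mem]
      refine ⟨h1, ?_, ?_⟩
      · rintro rfl; exact absurd h2.1.1 (by simp)
      · rintro rfl; exact h2.1.2.2 (Finset.subset_univ _)
    rcases List.mem_append.1 hm with hm | hm
    · exact hm
    · exfalso
      rcases List.mem_cons.1 hm with hm | hm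
      · exact h2.1.2.ne hm
      · have h3 := (List.pairwise_append.1 h.sorted).2.1
        exact (List.pairwise_cons.1 h3).1 H hm h2.1.2

theorem Good.between_nil {pre : List (Finset E)} {F : Finset E} (h : M.Good pre [])
    (P : Finset E → Prop) [DecidablePred P] (f : Finset E → ℤ) :
    (pre.map (fun H => if F ⊂ H ∧ P H then f H else 0)).sum =
     ∑ H ∈ M.flats.filter (fun H => (F ⊂ H ∧ H ⊂ Finset.univ) ∧ P H), f H := by
  have hnd : pre.Nodup := (List.nodup_append.1 h.nodup).1
  rw [← List.sum_toFinset _ hnd, ← Finset.sum_filter]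
  apply Finset.sum_congr _ (fun _ _ => rfl)
  ext H
  have := h.mem H
  simp only [List.append_nil] at this
  simp only [Finset.mem_filter, List.mem_toFinset, this]
  constructor
  · rintro ⟨⟨h1, h2, h3⟩, h4⟩
    exact ⟨h1, ⟨h4.1, Finset.ssubset_univ_iff.2 h3⟩, h4.2⟩
  · rintro ⟨h1, ⟨h2, h3⟩, h4⟩
    refine ⟨⟨h1, ?_, Finset.ssubset_univ_iff.1 h3⟩, h2, h4⟩
    rintro rfl; exact absurd h2 (by simp)

theorem bump_sum_zero {pre l : List (Finset E)} {G : Finset E} (h : M.Good pre (G :: l))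
    (m : Finset E → ℕ) (hm : m G = 0) (F : Finset E) (d t : ℕ) (a : E) :
    ((G :: l).map (fun H => if a ∈ H then M.V (bump m H) (G :: l) F d t else 0)).sum =
    (if a ∈ G then (if F ⊂ G then M.psi F G d t * M.V m l G 1 (t + 1) else 0) else 0) +
    (l.map (fun H => if a ∈ H then M.V (bump m H) l F d t else 0)).sum := by
  rw [List.map_cons, List.sum_cons]
  congr 1
  · have hb : bump m G G = 1 := by simp [bump, hm]
    rw [V, hb, M.V_congr (m := bump m G) (m' := m) l G]
    · simp
    · intro K hK
      have : K ≠ G := fun hh => h.notMem (hh ▸ hK)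
      simp [bump, this]
  · congr 1
    apply List.map_congr_left
    intro H hH
    have : G ≠ H := fun hh => h.notMem (hh ▸ hH)
    have hb : bump m H G = 0 := by simp [bump, hm, this]
    rw [V, hb]; simp

theorem bump_sum_pos {pre l : List (Finset E)} {G : Finset E} (h : M.Good pre (G :: l))
    (m : Finset E → ℕ) (hm : m G ≠ 0) (F : Finset E) (hFG : F ⊂ G) (d t : ℕ) (a : E) :
    ((G :: l).map (fun H => if a ∈ H then M.V (bump m H) (G :: l) F d t else 0)).sum =
    M.psi F G d t * ((if a ∈ G then M.V m l G (m G + 1) (t + m G + 1) else 0) +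
    (l.map (fun H => if a ∈ H then M.V (bump m H) l G (m G) (t + m G) else 0)).sum) := by
  rw [List.map_cons, List.sum_cons, mul_add]
  congr 1
  · have hb : bump m G G = m G + 1 := by simp [bump]
    rw [V, hb, M.V_congr (m := bump m G) (m' := m) l G]
    · simp [hFG, add_assoc]
    · intro K hK
      have : K ≠ G := fun hh => h.notMem (hh ▸ hK)
      simp [bump, this]
  · rw [← List.sum_map_mul_left]
    congr 1
    apply List.map_congr_left
    intro H hH
    have : G ≠ H := fun hh => h.notMem (hh ▸ hH)
    have hb : bump m H G = m G := by simp [bump, this]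
    rw [V, hb]; simp [hm, hFG]

theorem bump_sum_not {l : List (Finset E)} {G : Finset E}
    (m : Finset E → ℕ) (hm : m G ≠ 0) (F : Finset E) (hFG : ¬ F ⊂ G) (d t : ℕ) (a : E) :
    ((G :: l).map (fun H => if a ∈ H then M.V (bump m H) (G :: l) F d t else 0)).sum = 0 := by
  apply List.sum_eq_zero
  intro x hx
  obtain ⟨H, hH, rfl⟩ := List.mem_map.1 hx
  have : bump m H G ≠ 0 := by simp [bump, hm]
  simp [V, this, hFG]

theorem pre_sum_zero {pre : List (Finset E)} {G : Finset E} (h : ∀ H ∈ pre, ¬ G ⊂ H)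
    (P : Finset E → Prop) [DecidablePred P] (f : Finset E → ℤ) :
    (pre.map (fun H => if G ⊂ H ∧ P H then f H else 0)).sum = 0 := by
  apply List.sum_eq_zero
  intro x hx
  obtain ⟨H, hH, rfl⟩ := List.mem_map.1 hx
  simp [h H hH]

theorem pre_sum_pos {pre l : List (Finset E)} {G : Finset E} (h : M.Good pre (G :: l))
    (m : Finset E → ℕ) (hm : m G ≠ 0) (F : Finset E) (d t : ℕ)
    (P : Finset E → Prop) [DecidablePred P] :
    (pre.map (fun H => if F ⊂ H ∧ P H then M.psi F H d t * M.V m (G :: l) H 1 (t + 1)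
      else 0)).sum =
    (∑ H ∈ M.flats.filter (fun H => (F ⊂ H ∧ H ⊂ G) ∧ P H),
      M.psi F H d t * M.psi H G 1 (t+1)) * M.V m l G (m G) (t + 1 + m G) := by
  rw [← h.between, ← List.sum_map_mul_right]
  congr 1
  apply List.map_congr_left
  intro H hH
  simp only [V, hm, if_false]
  split_ifs <;> first | (exfalso; tauto; done) | ring

theorem pre_sum_not {pre l : List (Finset E)} {G : Finset E} 
    (m : Finset E → ℕ) (hm : m G ≠ 0) (F : Finset E) (hFG : ¬ F ⊂ G) (d t : ℕ)
    (P : Finset E → Prop) [DecidablePred P] :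
    (pre.map (fun H => if F ⊂ H ∧ P H then M.psi F H d t * M.V m (G :: l) H 1 (t + 1)
      else 0)).sum = 0 := by
  apply List.sum_eq_zero
  intro x hx
  obtain ⟨H, hH, rfl⟩ := List.mem_map.1 hx
  simp only [V, hm, if_false]
  split_ifs with h1 h2
  · exact absurd (h1.1.trans h2) hFG
  · simp
  · rfl

theorem claim1 (a : E) (m : Finset E → ℕ) (l : List (Finset E)) :
    ∀ (pre : List (Finset E)) (F : Finset E) (d t : ℕ), M.Good pre l → F ∈ M.flats →
    F ≠ Finset.univ → 1 ≤ d → a ∈ F → t + (l.map m).sum + 2 ≤ M.rk Finset.univ →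
    M.V m l F (d+1) (t+1) +
      (pre.map (fun H => if F ⊂ H ∧ True then M.psi F H d t * M.V m l H 1 (t + 1) else 0)).sum +
      (l.map (fun H => if a ∈ H then M.V (bump m H) l F d t else 0)).sum =
    M.V m l F d (t+1) - M.V m l F d t := by
  induction l with
  | nil =>
    intro pre F d t hg hF hFu hd ha ht
    have := M.key1 (G := Finset.univ) hF (Finset.ssubset_univ_iff.2 hFu) hd (t := t)
      (by simp at ht; omega)
    rw [hg.between_nil (fun _ => True)]
    simp only [V, and_true, List.map_nil, List.sum_nil, add_zero]
    exact this
  | cons G l ih =>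
    intro pre F d t hg hF hFu hd ha ht
    rw [List.map_cons, List.sum_cons] at ht
    by_cases hm : m G = 0
    · have := ih (pre ++ [G]) F d t hg.shift hF hFu hd ha (by omega)
      rw [bump_sum_zero hg m hm]
      simp only [V, hm, if_true]
      rw [List.map_append, List.sum_append] at this
      simp only [List.map_cons, List.map_nil, List.sum_cons, List.sum_nil, add_zero] at this
      rw [← this]
      by_cases hFG : F ⊂ G
      · simp [hFG, hFG.1 ha]; ring
      · simp [hFG]
    · by_cases hFG : F ⊂ G
      · have haG := hFG.1 ha
        obtain ⟨hGf, hG0, hGu⟩ := hg.flat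
        have := ih (pre ++ [G]) G (m G) (t + m G) hg.shift hGf hGu (by omega) haG (by omega)
        rw [pre_sum_zero hg.pre_not] at this
        rw [bump_sum_pos hg m hm F hFG, pre_sum_pos hg m hm F]
        simp only [V, hm, hFG, haG, if_true, if_false]
        have e : t + 1 + m G = t + m G + 1 := by ring
        rw [e]
        by_cases htG : t + 1 < M.rk G
        · have k := M.key1 hF hFG hd htG
          simp only [and_true]
          linear_combination (M.V m l G (m G) (t + m G + 1)) * k + M.psi F G d t * this
        · have z := M.V_big m l G (m G) (t + m G + 1) (by omega) (by omega)
          rw [z] at this ⊢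
          linear_combination M.psi F G d t * this
      · rw [bump_sum_not m hm F hFG, pre_sum_not m hm F hFG]
        simp [V, hm, hFG]

theorem claim2 (a : E) (m : Finset E → ℕ) (l : List (Finset E)) :
    ∀ (pre : List (Finset E)) (F : Finset E) (d t : ℕ), M.Good pre l → F ∈ M.flats →
    1 ≤ d → a ∉ F → t + (l.map m).sum + 2 ≤ M.rk Finset.univ →
      (pre.map (fun H => if F ⊂ H ∧ a ∈ H then
        M.psi F H d t * M.V m l H 1 (t + 1) else 0)).sum +
      (l.map (fun H => if a ∈ H then M.V (bump m H) l F d t else 0)).sum =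
    - M.V m l F d t := by
  induction l with
  | nil =>
    intro pre F d t hg hF hd ha ht
    have := M.key2 (G := Finset.univ) (d := d) (t := t) hF M.ground_mem ha (by simp)
      (by simp at ht; omega)
    rw [hg.between_nil]
    simp only [V, List.map_nil, List.sum_nil, add_zero]
    exact this
  | cons G l ih =>
    intro pre F d t hg hF hd ha ht
    rw [List.map_cons, List.sum_cons] at ht
    by_cases hm : m G = 0
    · have := ih (pre ++ [G]) F d t hg.shift hF hd ha (by omega)
      rw [bump_sum_zero hg m hm]
      simp only [V, hm, if_true]
      rw [List.map_append, List.sum_append] at this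
      simp only [List.map_cons, List.map_nil, List.sum_cons, List.sum_nil, add_zero] at this
      rw [← this]
      by_cases hFG : F ⊂ G <;> by_cases haG : a ∈ G <;> simp [hFG, haG]; ring
    · by_cases hFG : F ⊂ G
      · obtain ⟨hGf, hG0, hGu⟩ := hg.flat
        rw [bump_sum_pos hg m hm F hFG, pre_sum_pos hg m hm F]
        have e : t + 1 + m G = t + m G + 1 := by ring
        rw [e]
        by_cases haG : a ∈ G
        · have := claim1 a m l (pre ++ [G]) G (m G) (t + m G) hg.shift hGf hGu
            (by omega) haG (by omega)
          rw [pre_sum_zero hg.pre_not] at this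
          simp only [V, hm, hFG, haG, if_true, if_false]
          by_cases htG : t + 1 < M.rk G
          · have k := M.key2 (d := d) hF hGf ha haG htG
            linear_combination (M.V m l G (m G) (t + m G + 1)) * k + M.psi F G d t * this
          · have z := M.V_big m l G (m G) (t + m G + 1) (by omega) (by omega)
            rw [z] at this ⊢
            linear_combination M.psi F G d t * this
        · have := ih (pre ++ [G]) G (m G) (t + m G) hg.shift hGf (by omega) haG (by omega)
          rw [pre_sum_zero hg.pre_not] at this
          rw [Finset.sum_eq_zero]
          · simp only [V, hm, hFG, haG, if_true, if_false]
            linear_combination M.psi F G d t * this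
          · intro H hH
            have := (Finset.mem_filter.1 hH).2
            exact absurd (this.1.2.1 this.2) haG
      · rw [bump_sum_not m hm F hFG, pre_sum_not m hm F hFG]
        simp [V, hm, hFG]

/-- Non-vanishing forces chain support and lower bounds of the partial sums. -/
theorem V_ne {m : Finset E → ℕ} (l : List (Finset E)) :
    ∀ (pre : List (Finset E)) (F : Finset E) (d t : ℕ), M.Good pre l → F ∈ M.flats →
    M.V m l F d t ≠ 0 → M.rk F ≤ t ∧
      (∀ G ∈ l, m G ≠ 0 → F ⊂ G ∧ M.rk G ≤ t + ((l.filter (fun H => H ⊆ G)).map m).sum) ∧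
      (∀ G ∈ l, ∀ H ∈ l, m G ≠ 0 → m H ≠ 0 → G ⊆ H ∨ H ⊆ G) := by
  induction l with
  | nil =>
    intro pre F d t hg hF hV
    refine ⟨?_, by simp, by simp⟩
    by_contra hlt
    exact hV (M.psi_lt hF (by omega))
  | cons K l ih =>
    intro pre F d t hg hF hV
    rw [V] at hV
    split_ifs at hV with hm hFK
    · obtain ⟨h1, h2, h3⟩ := ih _ F d t hg.shift hF hV
      refine ⟨h1, ?_, ?_⟩
      · intro G hG hmG
        rcases List.mem_cons.1 hG with rfl | hG
        · exact absurd hm hmG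
        · refine ⟨(h2 G hG hmG).1, ?_⟩
          have := (h2 G hG hmG).2
          rw [List.filter_cons]
          split_ifs
          · simp only [List.map_cons, List.sum_cons]; omega
          · exact this
      · intro G hG H hH hmG hmH
        rcases List.mem_cons.1 hG with rfl | hG
        · exact absurd hm hmG
        rcases List.mem_cons.1 hH with rfl | hH
        · exact absurd hm hmH
        exact h3 G hG H hH hmG hmH
    · have hpsi := left_ne_zero_of_mul hV
      have hrest := right_ne_zero_of_mul hV
      obtain ⟨h1, h2, h3⟩ := ih _ K _ _ hg.shift hg.flat.1 hrest
      refine ⟨?_, ?_, ?_⟩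
      · by_contra hlt
        exact hpsi (M.psi_lt hF (by omega))
      · intro G hG hmG
        rcases List.mem_cons.1 hG with rfl | hG
        · refine ⟨hFK, ?_⟩
          rw [List.filter_cons]
          simp only [subset_refl, decide_true, if_true, List.map_cons, List.sum_cons]
          omega
        · have := h2 G hG hmG
          refine ⟨hFK.trans this.1, ?_⟩
          rw [List.filter_cons]
          simp only [this.1.1, decide_true, if_true, List.map_cons, List.sum_cons]
          omega
      · intro G hG H hH hmG hmH
        rcases List.mem_cons.1 hG with rfl | hG
        · rcases List.mem_cons.1 hH with rfl | hH
          · exact Or.inl le_rfl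
          · exact Or.inl (h2 H hH hmH).1.1
        · rcases List.mem_cons.1 hH with hHK | hH
          · rw [hHK]; exact Or.inr (h2 G hG hmG).1.1
          · exact h3 G hG H hH hmG hmH
    · exact absurd rfl hV

/-- The unit values. -/
theorem V_unit {m : Finset E → ℕ} (l : List (Finset E)) :
    ∀ (pre : List (Finset E)) (F : Finset E) (d t : ℕ), M.Good pre l → F ∈ M.flats →
    M.rk F = t → 
      (∀ G ∈ l, m G ≠ 0 → F ⊂ G ∧ t + ((l.filter (fun H => H ⊆ G)).map m).sum = M.rk G) →
      (∀ G ∈ l, ∀ H ∈ l, m G ≠ 0 → m H ≠ 0 → G ⊆ H ∨ H ⊆ G) →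
    IsUnit (M.V m l F d t) := by
  induction l with
  | nil =>
    intro pre F d t hg hF hr _ _
    rw [V, ← hr, M.psi_rk hF (Finset.subset_univ _)]
    exact isUnit_one.neg
  | cons K l ih =>
    intro pre F d t hg hF hr h2 h3
    rw [V]
    have h3' : ∀ G ∈ l, ∀ H ∈ l, m G ≠ 0 → m H ≠ 0 → G ⊆ H ∨ H ⊆ G :=
      fun G hG H hH => h3 G (by simp [hG]) H (by simp [hH])
    split_ifs with hm hFK
    · apply ih _ F d t hg.shift hF hr _ h3'
      intro G hG hmG
      have := h2 G (by simp [hG]) hmG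
      refine ⟨this.1, ?_⟩
      rw [← this.2, List.filter_cons]
      split_ifs <;> simp [hm]
    · rw [← hr, M.psi_rk hF hFK.1]
      refine isUnit_one.neg.mul ?_
      have hK := (h2 K (by simp) hm).2
      -- nothing below `K` in `l`
      have hnone : ∀ H ∈ l, ¬ H ⊆ K := by
        intro H hH hHK
        have h4 := (List.pairwise_append.1 hg.sorted).2.1
        have h5 := (List.pairwise_cons.1 h4).1 H hH
        have h6 : H ≠ K := fun hh => hg.notMem (hh ▸ hH)
        exact h5 (lt_of_le_of_ne hHK h6)
      rw [List.filter_cons] at hK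
      simp only [subset_refl, decide_true, if_true, List.map_cons, List.sum_cons] at hK
      rw [List.filter_eq_nil_iff.2 (by simpa using hnone)] at hK
      simp only [List.map_nil, List.sum_nil, add_zero] at hK
      apply ih _ K _ _ hg.shift hg.flat.1 (by omega) _ h3'
      intro G hG hmG
      have hKG : K ⊂ G := by
        have h6 : K ≠ G := fun hh => hg.notMem (hh ▸ hG)
        rcases h3 K (by simp) G (by simp [hG]) hm hmG with h | h
        · exact lt_of_le_of_ne h h6
        · exact absurd h (hnone G hG)
      refine ⟨hKG, ?_⟩
      have := (h2 G (by simp [hG]) hmG).2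
      rw [List.filter_cons] at this
      simp only [hKG.1, decide_true, if_true, List.map_cons, List.sum_cons] at this
      omega
    · exact absurd (h2 K (by simp) hm).1 hFK

/-- existence of a linear extension. -/
theorem exists_good : ∃ l, M.Good [] l := by
  classical
  let r : Finset E → Finset E → Prop := fun A B => A.card ≤ B.card
  let s := M.flats.filter (fun H => H ≠ ∅ ∧ H ≠ Finset.univ)
  refine ⟨s.toList.mergeSort (fun A B => A.card ≤ B.card), ?_, ?_, ?_⟩
  · rw [List.nil_append]
    exact ((List.mergeSort_perm _ _).nodup_iff).2 s.nodup_toList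
  · intro H
    simp [s]
  · rw [List.nil_append]
    have := List.pairwise_mergeSort (le := fun A B : Finset E => decide (A.card ≤ B.card))
      (by intro a b c; simp; omega) (by intro a b; simp; omega) s.toList
    refine this.imp ?_
    intro A B hAB hBA
    have := Finset.card_lt_card hBA
    simp at hAB
    omega

end functional
end SimpleFlatMatroid

namespace SimpleFlatMatroid

section independence
variable {E : Type*} [Fintype E] [DecidableEq E] {M : SimpleFlatMatroid E}

/-- extend an exponent vector by zero -/
def ext (e : FlatVar M →₀ ℕ) : Finset E → ℕ :=
  fun F => if h : F ∈ M.flats ∧ F ≠ ∅ then e ⟨F, h⟩ else 0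

theorem ext_coe (e : FlatVar M →₀ ℕ) (F : FlatVar M) : ext e F.1 = e F := by
  simp [ext, F.2]

theorem ext_add (e f : FlatVar M →₀ ℕ) : ext (e + f) = fun F => ext e F + ext f F := by
  funext F
  simp only [ext]
  split_ifs <;> simp

theorem ext_single (F : FlatVar M) (e : FlatVar M →₀ ℕ) :
    ext (e + Finsupp.single F 1) = bump (ext e) F.1 := by
  funext K
  rw [ext_add]
  simp only [bump]
  congr 1
  by_cases hK : K ∈ M.flats ∧ K ≠ ∅
  · have : (F = ⟨K, hK⟩) ↔ K = F.1 := by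
      rw [Subtype.ext_iff]; exact eq_comm
    simp only [ext, dif_pos hK, Finsupp.single_apply, this]
  · have : K ≠ F.1 := by
      rintro rfl; exact hK F.2
    simp [ext, hK, this]

theorem sum_flatVar [Nonempty E] {l : List (Finset E)} (hl : M.Good [] l) {A : Type*}
    [AddCommMonoid A] (f : Finset E → A) :
    ∑ F : FlatVar M, f F.1 = f Finset.univ + (l.map f).sum := by
  have hnd : l.Nodup := by simpa using hl.nodup
  have hm : ∀ H, H ∈ l ↔ H ∈ M.flats ∧ H ≠ ∅ ∧ H ≠ Finset.univ := by simpa using hl.mem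
  rw [← List.sum_toFinset _ hnd, ← Finset.sum_insert (by simp [hm])]
  rw [Finset.sum_subtype (p := fun F => F ∈ M.flats ∧ F ≠ ∅)]
  intro H
  simp only [Finset.mem_insert, List.mem_toFinset, hm]
  by_cases h : H = Finset.univ
  · subst h; simp [M.ground_mem, Finset.univ_nonempty.ne_empty]
  · simp [h]

/-- the degree functional -/
noncomputable def degFun (M : SimpleFlatMatroid E) (l : List (Finset E)) :
    ChowPoly M →ₗ[ℤ] ℤ :=
  (MvPolynomial.basisMonomials (FlatVar M) ℤ).constr ℤ
    (fun e => if e.degree + 1 = M.rk Finset.univ then M.V (ext e) l ∅ 1 0 else 0)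

theorem degFun_monomial (l : List (Finset E)) (e : FlatVar M →₀ ℕ) (c : ℤ) :
    degFun M l (MvPolynomial.monomial e c) =
      c * if e.degree + 1 = M.rk Finset.univ then M.V (ext e) l ∅ 1 0 else 0 := by
  have h : MvPolynomial.monomial e c = c • MvPolynomial.basisMonomials (FlatVar M) ℤ e := by
    rw [MvPolynomial.coe_basisMonomials, MvPolynomial.smul_monomial]; simp
  rw [h, map_smul, degFun, Module.Basis.constr_basis, smul_eq_mul]

theorem degFun_ideal [Nonempty E] {l : List (Finset E)} (hl : M.Good [] l) (p : ChowPoly M)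
    (hp : p ∈ chowIdeal M) : ∀ q : ChowPoly M, degFun M l (q * p) = 0 := by
  unfold chowIdeal at hp
  have hm : ∀ H, H ∈ l ↔ H ∈ M.flats ∧ H ≠ ∅ ∧ H ≠ Finset.univ := by simpa using hl.mem
  induction hp using Submodule.span_induction with
  | zero => simp
  | add x y _ _ hx hy => intro q; rw [mul_add, map_add, hx, hy, add_zero]
  | smul a x _ hx => intro q; rw [smul_eq_mul, ← mul_assoc, hx]
  | mem x hx =>
    intro q
    induction q using MvPolynomial.induction_on' with
    | add p q hp hq => rw [add_mul, map_add, hp, hq, add_zero]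
    | monomial u c =>
    rcases hx with ⟨F, F', h1, h2, rfl⟩ | ⟨a, rfl⟩
    · rw [MvPolynomial.X, MvPolynomial.X, MvPolynomial.monomial_mul, MvPolynomial.monomial_mul,
        degFun_monomial]
      have : M.V (ext (u + (Finsupp.single F 1 + Finsupp.single F' 1))) l ∅ 1 0 = 0 := by
        by_contra hV
        obtain ⟨-, -, h3⟩ := V_ne l [] ∅ 1 0 hl M.empty_mem hV
        have hF : F.1 ∈ l := (hm _).2 ⟨F.2.1, F.2.2, fun h => h2 (h ▸ Finset.subset_univ _)⟩
        have hF' : F'.1 ∈ l := (hm _).2 ⟨F'.2.1, F'.2.2, fun h => h1 (h ▸ Finset.subset_univ _)⟩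
        have := h3 _ hF _ hF' (by rw [ext_coe]; simp) (by rw [ext_coe]; simp)
        tauto
      rw [this]; simp
    · rw [Finset.mul_sum, map_sum]
      have hterm : ∀ F : FlatVar M, degFun M l (MvPolynomial.monomial u c *
          if a ∈ F.1 then MvPolynomial.X F else 0) =
          c * (if u.degree + 2 = M.rk Finset.univ then
            (if a ∈ F.1 then M.V (bump (ext u) F.1) l ∅ 1 0 else 0) else 0) := by
        intro F
        split_ifs with h1 h2 h2
        · rw [MvPolynomial.X, MvPolynomial.monomial_mul, degFun_monomial, ext_single, map_add]
          simp [← h2]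
        · rw [MvPolynomial.X, MvPolynomial.monomial_mul, degFun_monomial, map_add, if_neg (by simp; omega)]
          simp
        · simp
        · simp
      rw [Finset.sum_congr rfl (fun F _ => hterm F)]
      split_ifs with hdeg
      · rw [← Finset.mul_sum, sum_flatVar hl
          (fun H => if a ∈ H then M.V (bump (ext u) H) l ∅ 1 0 else 0)]
        have hd : u.degree = ext u Finset.univ + (l.map (ext u)).sum := by
          rw [← sum_flatVar hl, Finsupp.degree_eq_sum]
          exact Finset.sum_congr rfl (fun F _ => (ext_coe u F).symm)
        have := claim2 (M := M) a (ext u) l [] ∅ 1 0 hl M.empty_mem le_rfl (by simp) (by omega)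
        simp only [List.map_nil, List.sum_nil, zero_add] at this
        rw [this]
        have hc : M.V (bump (ext u) Finset.univ) l ∅ 1 0 = M.V (ext u) l ∅ 1 0 := by
          apply M.V_congr
          intro G hG
          simp [bump, ((hm G).1 hG).2.2]
        rw [hc]; simp
      · simp

/-! ### prevFlat -/

theorem prev_spec (n : Finset E → ℕ) (hc : ∀ F F' : Finset E, n F ≠ 0 → n F' ≠ 0 → F ⊆ F' ∨ F' ⊆ F)
    (G : Finset E) (hG : G ≠ ∅) :
    (prevFlat n G = ∅ ∨ n (prevFlat n G) ≠ 0) ∧ prevFlat n G ⊂ G ∧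
    ∀ H, n H ≠ 0 → H ⊂ G → H ⊆ prevFlat n G := by
  have h3 : ∀ H, n H ≠ 0 → H ⊂ G → H ⊆ prevFlat n G := by
    intro H h1 h2
    have := Finset.le_sup (f := fun F' => if n F' ≠ 0 ∧ F' ⊂ G then F' else ∅)
      (Finset.mem_univ H)
    simp only [h1, h2, ne_eq, not_false_eq_true, and_self, if_true] at this
    exact this
  have h12 : ∀ s : Finset (Finset E),
      (s.sup fun F' => if n F' ≠ 0 ∧ F' ⊂ G then F' else ∅) = ∅ ∨
      (n (s.sup fun F' => if n F' ≠ 0 ∧ F' ⊂ G then F' else ∅) ≠ 0 ∧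
       (s.sup fun F' => if n F' ≠ 0 ∧ F' ⊂ G then F' else ∅) ⊂ G) := by
    intro s
    induction s using Finset.induction_on with
    | empty => left; simp
    | insert a s ha ih =>
      rw [Finset.sup_insert]
      split_ifs with h
      · rcases ih with ih | ih
        · right; rw [ih]; simpa using h
        · right
          rcases hc _ _ h.1 ih.1 with h' | h'
          · rw [sup_eq_right.2 h']; exact ih
          · rw [sup_eq_left.2 h']; exact h
      · simpa using ih
  have h := h12 Finset.univ
  refine ⟨h.imp id (fun h => h.1), ?_, h3⟩
  rcases h with h | h
  · have h' : prevFlat n G = ∅ := h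
    rw [h']
    exact Finset.nonempty_iff_ne_empty.2 hG |>.empty_ssubset
  · exact h.2

theorem IsFY.prev_flat {n : Finset E → ℕ} (hn : M.IsFY n) {G : Finset E} (hG : G ≠ ∅) :
    prevFlat n G ∈ M.flats := by
  rcases (prev_spec n hn.2.1 G hG).1 with h | h
  · rw [h]; exact M.empty_mem
  · exact (hn.1 _ h).1

/-- sum of a monomial and its dual on proper flats -/
def fullExp (M : SimpleFlatMatroid E) (n : Finset E → ℕ) (G : Finset E) : ℕ :=
  if n G ≠ 0 ∧ G ≠ Finset.univ then M.rk G - M.rk (prevFlat n G) else 0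

theorem sum_fullExp {n : Finset E → ℕ} (hn : M.IsFY n) (k : ℕ) :
    ∀ G, G ≠ ∅ → G.card = k →
    ∑ H ∈ Finset.univ.filter (fun H => H ⊂ G), fullExp M n H = M.rk (prevFlat n G) := by
  induction k using Nat.strong_induction_on with
  | _ k ih =>
    intro G hG hk
    obtain ⟨h1, h2, h3⟩ := prev_spec n hn.2.1 G hG
    set P := prevFlat n G with hP
    have hPu : P ≠ Finset.univ := fun h => (h ▸ h2).2 (Finset.subset_univ _)
    have hz : ∑ H ∈ Finset.univ.filter (fun H => H ⊂ G), fullExp M n H =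
        ∑ H ∈ Finset.univ.filter (fun H => H ⊆ P), fullExp M n H := by
      symm
      apply Finset.sum_subset
      · intro H hH
        simp only [Finset.mem_filter, Finset.mem_univ, true_and] at hH ⊢
        exact lt_of_le_of_lt hH h2
      · intro H hH hHP
        simp only [Finset.mem_filter, Finset.mem_univ, true_and] at hH hHP
        rw [fullExp, if_neg]
        intro h
        exact hHP (h3 H h.1 hH)
    rw [hz]
    have hz2 : Finset.univ.filter (fun H => H ⊆ P) =
        insert P (Finset.univ.filter (fun H => H ⊂ P)) := by
      ext H
      simp only [Finset.mem_filter, Finset.mem_univ, true_and, Finset.mem_insert]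
      exact le_iff_eq_or_lt
    rw [hz2, Finset.sum_insert (by simp)]
    by_cases hP0 : P = ∅
    · rw [hP0, M.rk_empty]
      have h0 : n ∅ = 0 := by
        by_contra h
        exact (hn.1 ∅ h).2 rfl
      simp [fullExp, h0]
    · have hnP := h1.resolve_left hP0
      rw [ih P.card (hk ▸ Finset.card_lt_card h2) P hP0 rfl, fullExp, if_pos ⟨hnP, hPu⟩]
      have := hn.2.2 P hnP
      omega

theorem list_sum_fullExp {n : Finset E → ℕ} (hn : M.IsFY n) {l : List (Finset E)}
    (hl : M.Good [] l) (P : Finset E → Prop) [DecidablePred P] :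
    ((l.filter (fun H => P H)).map (fullExp M n)).sum =
      ∑ H ∈ Finset.univ.filter P, fullExp M n H := by
  have hnd : l.Nodup := by simpa using hl.nodup
  have hm : ∀ H, H ∈ l ↔ H ∈ M.flats ∧ H ≠ ∅ ∧ H ≠ Finset.univ := by simpa using hl.mem
  rw [← List.sum_toFinset _ (hnd.filter _)]
  apply Finset.sum_subset
  · intro H hH
    simp at hH ⊢
    exact hH.2
  · intro H hH hH'
    simp at hH hH'
    rw [fullExp, if_neg]
    rintro ⟨h1, h2⟩
    have := hn.1 H h1
    exact hH' ((hm H).2 ⟨this.1, this.2, h2⟩) hH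

theorem list_sum_le_fullExp {n : Finset E → ℕ} (hn : M.IsFY n) {l : List (Finset E)}
    (hl : M.Good [] l) {G : Finset E} (hG : n G ≠ 0) (hGu : G ≠ Finset.univ) :
    ((l.filter (fun H => H ⊆ G)).map (fullExp M n)).sum = M.rk G := by
  rw [list_sum_fullExp hn hl (fun H => H ⊆ G)]
  have hG0 := (hn.1 G hG).2
  have hz2 : Finset.univ.filter (fun H => H ⊆ G) =
      insert G (Finset.univ.filter (fun H => H ⊂ G)) := by
    ext H
    simp only [Finset.mem_filter, Finset.mem_univ, true_and, Finset.mem_insert]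
    exact le_iff_eq_or_lt
  rw [hz2, Finset.sum_insert (by simp), sum_fullExp hn _ G hG0 rfl, fullExp, if_pos ⟨hG, hGu⟩]
  have := hn.2.2 G hG
  omega

theorem list_sum_univ_fullExp [Nonempty E] {n : Finset E → ℕ} (hn : M.IsFY n)
    {l : List (Finset E)}
    (hl : M.Good [] l) : (l.map (fullExp M n)).sum = M.rk (prevFlat n Finset.univ) := by
  have hm : ∀ H, H ∈ l ↔ H ∈ M.flats ∧ H ≠ ∅ ∧ H ≠ Finset.univ := by simpa using hl.mem
  rw [← sum_fullExp hn _ Finset.univ Finset.univ_nonempty.ne_empty rfl,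
    ← list_sum_fullExp hn hl (fun H => H ⊂ Finset.univ)]
  rw [List.filter_eq_self.2]
  intro H hH
  simpa [Finset.ssubset_univ_iff] using ((hm H).1 hH).2.2

/-- dual exponents on proper flats -/
def dualExp (M : SimpleFlatMatroid E) (n : Finset E → ℕ) (G : Finset E) : ℕ :=
  fullExp M n G - n G

theorem le_fullExp {n : Finset E → ℕ} (hn : M.IsFY n) {G : Finset E}
    (hGu : G ≠ Finset.univ) : n G ≤ fullExp M n G ∧ (n G ≠ 0 → n G < fullExp M n G) := by
  by_cases h : n G = 0
  · simp [h]
  · have := hn.2.2 G h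
    rw [fullExp, if_pos ⟨h, hGu⟩]
    omega

theorem deg_eq [Nonempty E] {n : Finset E → ℕ} (hn : M.IsFY n) {l : List (Finset E)}
    (hl : M.Good [] l) : deg n = n Finset.univ + (l.map n).sum := by
  rw [← sum_flatVar hl, deg]
  rw [← Finset.sum_subtype (Finset.univ.filter (fun F => F ∈ M.flats ∧ F ≠ ∅))
    (by simp) (f := n)]
  symm
  apply Finset.sum_subset (Finset.subset_univ _)
  intro H _ hH
  by_contra h
  exact hH (by simpa using hn.1 H h)

theorem dual_le [Nonempty E] {n : Finset E → ℕ} (hn : M.IsFY n) {l : List (Finset E)}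
    (hl : M.Good [] l) : deg n + (l.map (dualExp M n)).sum + 1 ≤ M.rk Finset.univ := by
  have hm : ∀ H, H ∈ l ↔ H ∈ M.flats ∧ H ≠ ∅ ∧ H ≠ Finset.univ := by simpa using hl.mem
  have h1 : (l.map n).sum + (l.map (dualExp M n)).sum = M.rk (prevFlat n Finset.univ) := by
    rw [← list_sum_univ_fullExp hn hl, ← List.sum_map_add]
    congr 1
    apply List.map_congr_left
    intro H hH
    have := (le_fullExp hn ((hm H).1 hH).2.2).1
    simp only [dualExp]; omega
  rw [deg_eq hn hl]
  have h2 := prev_spec n hn.2.1 Finset.univ Finset.univ_nonempty.ne_empty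
  have h3 := hn.prev_flat Finset.univ_nonempty.ne_empty
  by_cases h : n Finset.univ = 0
  · have := M.rk_lt h3 M.ground_mem h2.2.1
    omega
  · have := hn.2.2 _ h
    omega

theorem lex_lemma (p n : Finset E → ℕ) : ∀ l : List (Finset E),
    l.Pairwise (fun A B => ¬ B ⊂ A) → (∃ H ∈ l, p H ≠ n H) →
    (∀ H ∈ l, (∀ K ∈ l, K ⊂ H → p K = n K) → p H ≠ n H → n H < p H) →
    l.map n < l.map p
  | [], _, h, _ => by simp at h
  | G :: l, hs, hex, hmin => by
    rw [List.map_cons, List.map_cons]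
    rw [List.pairwise_cons] at hs
    by_cases hG : p G = n G
    · rw [hG, List.cons_lt_cons_self]
      apply lex_lemma p n l hs.2
      · obtain ⟨H, hH, hne⟩ := hex
        rcases List.mem_cons.1 hH with rfl | hH
        · exact absurd hG hne
        · exact ⟨H, hH, hne⟩
      · intro H hH hK
        apply hmin H (by simp [hH])
        intro K hKl hKH
        rcases List.mem_cons.1 hKl with rfl | hKl
        · exact hG
        · exact hK K hKl hKH
    · rw [List.cons_lt_cons_iff]
      left
      apply hmin G (by simp) _ hG
      intro K hK hKG
      rcases List.mem_cons.1 hK with rfl | hK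
      · exact absurd rfl hKG.ne
      · exact absurd hKG (hs.1 K hK)

theorem triangular [Nonempty E] {n p : Finset E → ℕ} (hn : M.IsFY n) (hp : M.IsFY p)
    (hd : deg p = deg n) (hne : p ≠ n) {l : List (Finset E)} (hl : M.Good [] l)
    (hV : M.V (fun H => p H + dualExp M n H) l ∅ 1 0 ≠ 0) : l.map n < l.map p := by
  have hm : ∀ H, H ∈ l ↔ H ∈ M.flats ∧ H ≠ ∅ ∧ H ≠ Finset.univ := by simpa using hl.mem
  have hnd : l.Nodup := by simpa using hl.nodup
  obtain ⟨-, h2, -⟩ := V_ne l [] ∅ 1 0 hl M.empty_mem hV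
  apply lex_lemma p n l (by simpa using hl.sorted)
  · by_contra hcon
    push Not at hcon
    apply hne
    have hu : p Finset.univ = n Finset.univ := by
      rw [deg_eq hn hl, deg_eq hp hl, List.map_congr_left hcon] at hd
      omega
    funext H
    by_cases hH : H = Finset.univ
    · rw [hH, hu]
    · by_cases hHl : H ∈ l
      · exact hcon H hHl
      · have hz : ∀ q, M.IsFY q → q H = 0 := by
          intro q hq
          by_contra h
          exact hHl ((hm H).2 ⟨(hq.1 H h).1, (hq.1 H h).2, hH⟩)
        rw [hz p hp, hz n hn]
  · intro H hH hK hpn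
    by_cases hnH : n H = 0
    · omega
    · have hHu := ((hm H).1 hH).2.2
      have h3 := (le_fullExp hn hHu).2 hnH
      have h4 := (h2 H hH (by simp only [dualExp]; omega)).2
      have h5 := list_sum_le_fullExp hn hl hnH hHu
      rw [zero_add, ← h5, ← List.sum_toFinset _ (hnd.filter _),
        ← List.sum_toFinset _ (hnd.filter _)] at h4
      have hmem : H ∈ (l.filter (fun K => K ⊆ H)).toFinset := by simp [hH]
      rw [← Finset.add_sum_erase _ _ hmem, ← Finset.add_sum_erase _ _ hmem] at h4
      have h6 : ∑ K ∈ (l.filter (fun K => K ⊆ H)).toFinset.erase H, fullExp M n K =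
          ∑ K ∈ (l.filter (fun K => K ⊆ H)).toFinset.erase H, (p K + dualExp M n K) := by
        apply Finset.sum_congr rfl
        intro K hK'
        simp at hK'
        have h7 := hK K hK'.2.1 (lt_of_le_of_ne hK'.2.2 hK'.1)
        have h8 := (le_fullExp hn ((hm K).1 hK'.2.1).2.2).1
        simp only [dualExp]; omega
      simp only [dualExp] at h4 h6
      omega

theorem diag_unit [Nonempty E] {n : Finset E → ℕ} (hn : M.IsFY n)
    {l : List (Finset E)} (hl : M.Good [] l) :
    IsUnit (M.V (fun H => n H + dualExp M n H) l ∅ 1 0) := by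
  have hm : ∀ H, H ∈ l ↔ H ∈ M.flats ∧ H ≠ ∅ ∧ H ≠ Finset.univ := by simpa using hl.mem
  have hf : M.V (fun H => n H + dualExp M n H) l ∅ 1 0 = M.V (fullExp M n) l ∅ 1 0 := by
    apply M.V_congr
    intro G hG
    have := (le_fullExp hn ((hm G).1 hG).2.2).1
    simp only [dualExp]; omega
  rw [hf]
  have hsup : ∀ G, fullExp M n G ≠ 0 → n G ≠ 0 ∧ G ≠ Finset.univ := by
    intro G h
    by_contra hh
    exact h (if_neg hh)
  apply V_unit l [] ∅ 1 0 hl M.empty_mem M.rk_empty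
  · intro G hG hmG
    refine ⟨(Finset.nonempty_iff_ne_empty.2 ((hm G).1 hG).2.1).empty_ssubset, ?_⟩
    rw [zero_add, list_sum_le_fullExp hn hl (hsup G hmG).1 (hsup G hmG).2]
  · intro G _ H _ h1 h2
    exact hn.2.1 G H (hsup G h1).1 (hsup H h2).1

theorem lin_indep_nonempty [Nonempty E] (k : ℕ) :
    LinearIndependent ℤ (fun m : M.FYk k => chowMk M (FYpoly M m.1)) := by
  obtain ⟨l, hl⟩ := exists_good (M := M)
  have hm : ∀ H, H ∈ l ↔ H ∈ M.flats ∧ H ≠ ∅ ∧ H ≠ Finset.univ := by simpa using hl.mem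
  rw [linearIndependent_iff]
  intro c hc
  by_contra hc0
  obtain ⟨n, hnc, hmax⟩ := Finset.exists_max_image c.support (fun m => l.map m.1)
    (Finsupp.support_nonempty_iff.2 hc0)
  have hmem : (c.sum fun m a => a • FYpoly M m.1) ∈ chowIdeal M := by
    rw [← Ideal.Quotient.eq_zero_iff_mem]
    rw [Finsupp.linearCombination_apply] at hc
    have : chowMk M (c.sum fun m a => a • FYpoly M m.1) = 0 := by
      rw [← hc, Finsupp.sum, map_sum, Finsupp.sum]
      simp
    exact this
  have hle := dual_le n.2.1 hl
  set v : FlatVar M →₀ ℕ := Finsupp.equivFunOnFinite.symm (fun F =>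
    if F.1 = Finset.univ then M.rk Finset.univ - 1 - k - (l.map (dualExp M n.1)).sum
    else dualExp M n.1 F.1) with hv
  have h0 := degFun_ideal hl _ hmem (MvPolynomial.monomial v 1)
  rw [Finsupp.sum, Finset.mul_sum, map_sum] at h0
  have hdv : v.degree = M.rk Finset.univ - 1 - k := by
    have := sum_flatVar hl (fun F : Finset E =>
      if F = Finset.univ then M.rk Finset.univ - 1 - k - (l.map (dualExp M n.1)).sum
      else dualExp M n.1 F)
    rw [Finsupp.degree_eq_sum, hv]
    simp only [Finsupp.equivFunOnFinite_symm_apply_apply]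
    have h2 : l.map (fun F : Finset E =>
      if F = Finset.univ then M.rk Finset.univ - 1 - k - (l.map (dualExp M n.1)).sum
      else dualExp M n.1 F) = l.map (dualExp M n.1) :=
      List.map_congr_left (fun H hH => if_neg ((hm H).1 hH).2.2)
    rw [this, h2, if_pos rfl]
    have := n.2.2; omega
  have hterm : ∀ p : M.FYk k, degFun M l (MvPolynomial.monomial v 1 * c p • FYpoly M p.1) =
      c p * M.V (fun H => p.1 H + dualExp M n.1 H) l ∅ 1 0 := by
    intro p
    rw [FYpoly, mul_smul_comm, map_smul, smul_eq_mul, MvPolynomial.monomial_mul, degFun_monomial]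
    congr 1
    rw [map_add, hdv, if_pos]
    · rw [one_mul, one_mul]
      apply M.V_congr
      intro G hG
      have hG' := (hm G).1 hG
      have := ext_coe (M := M) (v + Finsupp.equivFunOnFinite.symm fun F : FlatVar M => p.1 F.1)
        ⟨G, hG'.1, hG'.2.1⟩
      rw [this]
      simp [hv, hG'.2.2, add_comm]
    · have hdp : (Finsupp.equivFunOnFinite.symm fun F : FlatVar M => p.1 F.1).degree = k := by
        rw [Finsupp.degree_eq_sum]
        simp only [Finsupp.equivFunOnFinite_symm_apply_apply]
        rw [sum_flatVar hl, ← deg_eq p.2.1 hl, p.2.2]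
      rw [hdp]
      have := n.2.2
      omega
  rw [Finset.sum_congr rfl (fun p _ => hterm p), Finset.sum_eq_single_of_mem n hnc] at h0
  · rcases mul_eq_zero.1 h0 with h | h
    · exact (Finsupp.mem_support_iff.1 hnc) h
    · have := diag_unit n.2.1 hl
      rw [h] at this
      exact not_isUnit_zero this
  · intro p hp hpn
    by_contra hne
    have hV := right_ne_zero_of_mul hne
    have := triangular n.2.1 p.2.1 (p.2.2.trans n.2.2.symm)
      (fun h => hpn (Subtype.ext h)) hl hV
    exact absurd this (not_lt.2 (hmax p hp))

theorem lin_indep (k : ℕ) :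
    LinearIndependent ℤ (fun m : M.FYk k => chowMk M (FYpoly M m.1)) := by
  cases isEmpty_or_nonempty E with
  | inr h => exact lin_indep_nonempty k
  | inl h =>
    have hF : IsEmpty (FlatVar M) := ⟨fun F => F.2.2 (Finset.eq_empty_of_isEmpty F.1)⟩
    have hI : chowIdeal M = ⊥ := by
      rw [chowIdeal, Ideal.span_eq_bot]
      rintro x (⟨F, _⟩ | ⟨a, _⟩)
      · exact isEmptyElim F
      · exact isEmptyElim a
    have hsub : Subsingleton (M.FYk k) := by
      refine ⟨fun p q => Subtype.ext (funext fun H => ?_)⟩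
      have hz : ∀ q, M.IsFY q → q H = 0 := by
        intro q hq
        by_contra h
        exact (hq.1 H h).2 (Finset.eq_empty_of_isEmpty H)
      rw [hz _ p.2.1, hz _ q.2.1]
    have hinj : Function.Injective (chowMk M) := by
      intro x y hxy
      have : x - y ∈ chowIdeal M := Ideal.Quotient.eq.1 hxy
      rw [hI, Ideal.mem_bot] at this
      exact sub_eq_zero.1 this
    have h1 : LinearIndependent ℤ (fun m : M.FYk k => FYpoly M m.1) := by
      have := (MvPolynomial.basisMonomials (FlatVar M) ℤ).linearIndependent.comp
        (fun m : M.FYk k => Finsupp.equivFunOnFinite.symm fun F : FlatVar M => m.1 F.1)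
        (fun _ _ _ => Subsingleton.elim _ _)
      simpa [MvPolynomial.coe_basisMonomials, Function.comp_def, FYpoly] using this
    exact h1.map' (chowMk M).toLinearMap (LinearMap.ker_eq_bot.2 hinj)

end independence
end SimpleFlatMatroid

namespace SimpleFlatMatroid

section spanning
variable {E : Type*} [Fintype E] [DecidableEq E] (M : SimpleFlatMatroid E)

/-- the class of a monomial -/
noncomputable def cm (e : FlatVar M →₀ ℕ) : ChowRing M := chowMk M (MvPolynomial.monomial e 1)

theorem cm_add (e f : FlatVar M →₀ ℕ) : M.cm (e + f) = M.cm e * M.cm f := by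
  simp only [cm, ← map_mul, MvPolynomial.monomial_mul, one_mul]

theorem cm_zero : M.cm 0 = 1 := by
  simp only [cm]
  exact map_one _

/-- the class of a variable -/
noncomputable def cy (F : FlatVar M) : ChowRing M := M.cm (Finsupp.single F 1)

theorem cm_single (F : FlatVar M) (d : ℕ) : M.cm (Finsupp.single F d) = M.cy F ^ d := by
  induction d with
  | zero => simp [cm_zero]
  | succ d ih => rw [pow_succ, ← ih, Finsupp.single_add, cm_add, cy]

/-- exponent of `x_F`, with `x_∅ = 1` -/
noncomputable def zexp (F : Finset E) : FlatVar M →₀ ℕ :=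
  if h : F ∈ M.flats ∧ F ≠ ∅ then Finsupp.single ⟨F, h⟩ 1 else 0

theorem mk_eq_zero {p : ChowPoly M} (h : p ∈ chowIdeal M) : chowMk M p = 0 :=
  Ideal.Quotient.eq_zero_iff_mem.2 h

theorem cy_mul_zero (F G : FlatVar M) (h1 : ¬ F.1 ⊆ G.1) (h2 : ¬ G.1 ⊆ F.1) :
    M.cy F * M.cy G = 0 := by
  have := M.mk_eq_zero (p := MvPolynomial.X F * MvPolynomial.X G)
    (Ideal.subset_span (Or.inl ⟨F, G, h1, h2, rfl⟩))
  rw [map_mul] at this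
  exact this

theorem cy_sum (a : E) : ∑ F : FlatVar M, (if a ∈ F.1 then M.cy F else 0) = 0 := by
  have := M.mk_eq_zero (p := ∑ F : FlatVar M, if a ∈ F.1 then MvPolynomial.X F else 0)
    (Ideal.subset_span (Or.inr ⟨a, rfl⟩))
  rw [map_sum] at this
  refine Eq.trans ?_ this
  refine Finset.sum_congr rfl (fun F _ => ?_)
  split_ifs
  · rfl
  · rw [map_zero]

theorem cz_mul_zero (F : Finset E) (G : FlatVar M) (h1 : ¬ F ⊆ G.1) (h2 : ¬ G.1 ⊆ F)
    (hF : F ∈ M.flats) : M.cm (M.zexp F) * M.cy G = 0 := by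
  have hne : F ≠ ∅ := by rintro rfl; simp at h1
  rw [zexp, dif_pos ⟨hF, hne⟩]
  exact M.cy_mul_zero ⟨F, hF, hne⟩ G h1 h2

/-- the sum of the variables of the flats containing `S` -/
noncomputable def hs (S : Finset E) : ChowRing M :=
  ∑ H : FlatVar M, if S ⊆ H.1 then M.cy H else 0

theorem hs_claim (d : ℕ) : ∀ F ∈ M.flats, ∀ S : Finset E, (S \ F).Nonempty → (S \ F).card ≤ d →
    M.cm (M.zexp F) * M.hs S ^ d = 0 := by
  induction d with
  | zero =>
    intro F _ S h1 h2
    have := h1.card_pos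
    omega
  | succ d ih =>
    intro F hF S h1 h2
    obtain ⟨a, ha⟩ := h1
    have ha' := Finset.mem_sdiff.1 ha
    have hh : M.hs S = - ∑ H : FlatVar M, if a ∈ H.1 ∧ ¬ S ⊆ H.1 then M.cy H else 0 := by
      rw [eq_neg_iff_add_eq_zero, hs, ← Finset.sum_add_distrib]
      refine Eq.trans ?_ (M.cy_sum a)
      refine Finset.sum_congr rfl (fun H _ => ?_)
      by_cases h : S ⊆ H.1
      · simp [h, h ha'.1]
      · simp [h]
    have h0 : M.cm (M.zexp F) * (∑ H : FlatVar M, if a ∈ H.1 ∧ ¬ S ⊆ H.1 then M.cy H else 0)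
        * M.hs S ^ d = 0 := by
      rw [Finset.mul_sum, Finset.sum_mul]
      refine Finset.sum_eq_zero (fun H _ => ?_)
      split_ifs with h
      · have hHF : ¬ H.1 ⊆ F := fun hs => ha'.2 (hs h.1)
        by_cases hFH : F ⊆ H.1
        · have hz : M.cm (M.zexp H.1) = M.cy H := by
            rw [zexp, dif_pos H.2]; rfl
          have := ih H.1 H.2.1 S (Finset.sdiff_nonempty.2 h.2) (by
            have : (S \ H.1).card < (S \ F).card := by
              apply Finset.card_lt_card
              refine ⟨Finset.sdiff_subset_sdiff le_rfl hFH, fun hs => ?_⟩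
              exact (Finset.mem_sdiff.1 (hs ha)).2 h.1
            omega)
          rw [hz] at this
          rw [mul_assoc, this, mul_zero]
        · rw [M.cz_mul_zero F H hFH hHF hF, zero_mul]
      · simp
    calc M.cm (M.zexp F) * M.hs S ^ (d+1) = M.cm (M.zexp F) * M.hs S * M.hs S ^ d := by ring
      _ = 0 := by
        linear_combination (M.cm (M.zexp F) * M.hs S ^ d) * hh - h0

theorem hs_flat {F G : Finset E} (hF : F ∈ M.flats) (hG : G ∈ M.flats) (h : F ⊂ G) :
    M.cm (M.zexp F) * M.hs G ^ (M.rk G - M.rk F) = 0 := by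
  obtain ⟨-, h1, S, hS1, hS2, hS3⟩ := M.exists_span _ F G hF hG h.1 rfl
  have hlt := M.rk_lt hF hG h
  have hSn : S.Nonempty := by
    rw [← Finset.card_pos]; omega
  have hdis : ∀ a ∈ S, a ∉ F := fun a ha => (Finset.mem_sdiff.1 (hS1 ha)).2
  have hSF : S \ F = S := Finset.sdiff_eq_self_of_disjoint (Finset.disjoint_left.2 hdis)
  have h0 := M.hs_claim (M.rk G - M.rk F) F hF S (by rw [hSF]; exact hSn) (by rw [hSF]; omega)
  have heq : M.cm (M.zexp F) * M.hs S = M.cm (M.zexp F) * M.hs G := by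
    rw [hs, hs, Finset.mul_sum, Finset.mul_sum]
    refine Finset.sum_congr rfl (fun H _ => ?_)
    by_cases hSH : S ⊆ H.1
    · by_cases hFH : F ⊆ H.1
      · rw [if_pos hSH, if_pos (hS3 _ H.2.1 hFH hSH)]
      · obtain ⟨a, ha⟩ := hSn
        have hz := M.cz_mul_zero F H hFH (fun h => hdis a ha (h (hSH ha))) hF
        split_ifs <;> simp [hz]
    · rw [if_neg hSH, if_neg (fun h => hSH ((hS1.trans Finset.sdiff_subset).trans h))]
  have hpow : ∀ d, M.cm (M.zexp F) * M.hs S ^ d = M.cm (M.zexp F) * M.hs G ^ d := by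
    intro d
    induction d with
    | zero => simp
    | succ d ih =>
      calc _ = (M.cm (M.zexp F) * M.hs S ^ d) * M.hs S := by ring
        _ = (M.cm (M.zexp F) * M.hs S) * M.hs G ^ d := by rw [ih]; ring
        _ = _ := by rw [heq]; ring
  rw [← hpow, h0]

/-- the weight of a monomial -/
def wt (e : FlatVar M →₀ ℕ) : ℕ := ∑ F : FlatVar M, e F * F.1.card

theorem wt_add (e f : FlatVar M →₀ ℕ) : M.wt (e + f) = M.wt e + M.wt f := by
  simp [wt, add_mul, Finset.sum_add_distrib]

theorem wt_single (F : FlatVar M) (d : ℕ) : M.wt (Finsupp.single F d) = d * F.1.card := by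
  rw [wt, Finset.sum_eq_single F]
  · simp
  · intro b _ hb
    rw [Finsupp.single_apply, if_neg (Ne.symm hb), zero_mul]
  · simp

theorem wt_le (e : FlatVar M →₀ ℕ) : M.wt e ≤ e.degree * Fintype.card E := by
  rw [wt, Finsupp.degree_eq_sum, Finset.sum_mul]
  exact Finset.sum_le_sum (fun F _ => Nat.mul_le_mul le_rfl (Finset.card_le_univ _))

/-- span of the monomials of given degree and large weight -/
noncomputable def W (k w : ℕ) : Submodule ℤ (ChowRing M) :=
  Submodule.span ℤ (M.cm '' {e | e.degree = k ∧ w ≤ M.wt e})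

theorem cm_mem_W {k w : ℕ} (e : FlatVar M →₀ ℕ) (h1 : e.degree = k) (h2 : w ≤ M.wt e) :
    M.cm e ∈ M.W k w := Submodule.subset_span ⟨e, ⟨h1, h2⟩, rfl⟩

theorem W_mul {k w k' w' : ℕ} {a b : ChowRing M} (ha : a ∈ M.W k w) (hb : b ∈ M.W k' w') :
    a * b ∈ M.W (k + k') (w + w') := by
  have := Submodule.mul_mem_mul ha hb
  rw [W, W, Submodule.span_mul_span] at this
  refine Submodule.span_mono ?_ this
  rintro _ ⟨_, ⟨e, he, rfl⟩, _, ⟨f, hf, rfl⟩, rfl⟩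
  refine ⟨e + f, ⟨?_, ?_⟩, M.cm_add e f⟩
  · rw [map_add, he.1, hf.1]
  · rw [wt_add]; exact Nat.add_le_add he.2 hf.2

theorem cy_mem_W {w : ℕ} (F : FlatVar M) (h : w ≤ F.1.card) : M.cy F ∈ M.W 1 w :=
  M.cm_mem_W _ (by simp) (by rw [wt_single]; omega)

theorem hs_mem_W (G : Finset E) : M.hs G ∈ M.W 1 G.card := by
  refine Submodule.sum_mem _ (fun H _ => ?_)
  split_ifs with h
  · exact M.cy_mem_W H (Finset.card_le_card h)
  · exact Submodule.zero_mem _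

theorem hs_sub_mem_W (G : FlatVar M) : M.hs G.1 - M.cy G ∈ M.W 1 (G.1.card + 1) := by
  have : M.hs G.1 - M.cy G = ∑ H : FlatVar M, if G.1 ⊂ H.1 then M.cy H else 0 := by
    have h2 : M.cy G = ∑ H : FlatVar M, if H = G then M.cy H else 0 := by simp
    rw [hs]
    nth_rewrite 1 [h2]
    rw [← Finset.sum_sub_distrib]
    refine Finset.sum_congr rfl (fun H _ => ?_)
    by_cases h : H = G
    · subst h; simp
    · have h' : G.1 ≠ H.1 := fun hh => h (Subtype.ext hh.symm)
      simp only [h, if_false, sub_zero, Finset.ssubset_iff_subset_ne, ne_eq, h', not_false_eq_true,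
        and_true]
  rw [this]
  refine Submodule.sum_mem _ (fun H _ => ?_)
  split_ifs with h
  · exact M.cy_mem_W H (Finset.card_lt_card h)
  · exact Submodule.zero_mem _

theorem hs_pow_mem_W (G : Finset E) (d : ℕ) : M.hs G ^ d ∈ M.W d (d * G.card) := by
  induction d with
  | zero =>
    rw [pow_zero, ← cm_zero]
    exact M.cm_mem_W _ (by simp) (by simp)
  | succ d ih =>
    rw [pow_succ]
    have := M.W_mul ih (M.hs_mem_W G)
    rwa [show d * G.card + G.card = (d + 1) * G.card by ring] at this

theorem hs_pow_sub_mem_W (G : FlatVar M) (d : ℕ) :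
    M.hs G.1 ^ d - M.cy G ^ d ∈ M.W d (d * G.1.card + 1) := by
  induction d with
  | zero => simp
  | succ d ih =>
    have h1 := M.W_mul (M.hs_pow_mem_W G.1 d) (M.hs_sub_mem_W G)
    have h2 := M.W_mul ih (M.cy_mem_W G le_rfl)
    rw [show d * G.1.card + (G.1.card + 1) = (d + 1) * G.1.card + 1 by ring] at h1
    rw [show d * G.1.card + 1 + G.1.card = (d + 1) * G.1.card + 1 by ring] at h2
    have := Submodule.add_mem _ h1 h2
    convert this using 1
    ring

theorem deg_ext (e : FlatVar M →₀ ℕ) : deg (ext e) = e.degree := by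
  rw [deg, Finsupp.degree_eq_sum]
  rw [Finset.sum_congr rfl (fun F _ => (ext_coe e F).symm)]
  rw [← Finset.sum_subtype (p := fun F => F ∈ M.flats ∧ F ≠ ∅)
    (Finset.univ.filter fun F => F ∈ M.flats ∧ F ≠ ∅) (by simp) (ext e)]
  symm
  apply Finset.sum_subset (Finset.subset_univ _)
  intro F _ hF
  rw [ext, dif_neg (by simpa using hF)]

theorem FYpoly_ext (e : FlatVar M →₀ ℕ) : FYpoly M (ext e) = MvPolynomial.monomial e 1 := by
  rw [FYpoly]
  congr 1
  ext F
  simp [ext_coe]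

theorem cm_mem_span (k : ℕ) (n : ℕ) : ∀ e : FlatVar M →₀ ℕ, e.degree = k →
    k * Fintype.card E < M.wt e + n →
    M.cm e ∈ Submodule.span ℤ (Set.range fun m : M.FYk k => chowMk M (FYpoly M m.1)) := by
  induction n with
  | zero =>
    intro e he h
    have := M.wt_le e
    rw [he] at this
    omega
  | succ n ih =>
    intro e he h
    by_cases hFY : M.IsFY (ext e)
    · refine Submodule.subset_span ⟨⟨ext e, hFY, by rw [deg_ext, he]⟩, ?_⟩
      simp only [FYpoly_ext]; rfl
    have hfl : ∀ F : Finset E, ext e F ≠ 0 → F ∈ M.flats ∧ F ≠ ∅ := by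
      intro F hF
      by_contra hc
      exact hF (by rw [ext, dif_neg hc])
    by_cases hch : ∀ F F' : Finset E, ext e F ≠ 0 → ext e F' ≠ 0 → F ⊆ F' ∨ F' ⊆ F
    · have : ∃ G : Finset E, ext e G ≠ 0 ∧ M.rk G < ext e G + M.rk (prevFlat (ext e) G) + 1 := by
        by_contra hc
        push Not at hc
        exact hFY ⟨hfl, hch, hc⟩
      obtain ⟨G, hG0, hG⟩ := this
      have hGf := hfl G hG0
      obtain ⟨hp1, hp2, -⟩ := prev_spec (ext e) hch G hGf.2
      set F := prevFlat (ext e) G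
      have hF : F ∈ M.flats := by
        rcases hp1 with h | h
        · rw [h]; exact M.empty_mem
        · exact (hfl _ h).1
      set G' : FlatVar M := ⟨G, hGf⟩
      set d := M.rk G - M.rk F with hd
      have hext : ext e G = e G' := ext_coe e G'
      have hle : M.zexp F + Finsupp.single G' d ≤ e := by
        intro H
        rw [Finsupp.add_apply, zexp]
        by_cases hH : H = G'
        · subst hH
          have : (if h : F ∈ M.flats ∧ F ≠ ∅ then Finsupp.single (⟨F, h⟩ : FlatVar M) 1 else 0) G' = 0 := by
            split_ifs with h
            · rw [Finsupp.single_apply, if_neg]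
              intro hc
              exact hp2.ne (congrArg Subtype.val hc)
            · rfl
          rw [this, Finsupp.single_eq_same]
          omega
        · rw [Finsupp.single_apply, if_neg (Ne.symm hH), add_zero]
          split_ifs with h
          · rw [Finsupp.single_apply]
            split_ifs with h2
            · subst h2
              have : ext e F ≠ 0 := hp1.resolve_left h.2
              rw [ext, dif_pos h] at this
              omega
            · exact Nat.zero_le _
          · exact Nat.zero_le _
      obtain ⟨r, hr⟩ := exists_add_of_le hle
      have h1 : M.cm e = -(M.cm (M.zexp F) * (M.hs G ^ d - M.cy G' ^ d) * M.cm r) := by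
        rw [mul_sub, M.hs_flat hF hGf.1 hp2, ← cm_single, hr, cm_add, cm_add]
        ring
      have h2 := M.W_mul (M.W_mul (M.cm_mem_W (M.zexp F) rfl le_rfl) (M.hs_pow_sub_mem_W G' d))
        (M.cm_mem_W r rfl le_rfl)
      have h3 : (M.zexp F).degree + d + r.degree = k := by
        rw [← he, hr, map_add, map_add]; simp
      have h4 : M.wt (M.zexp F) + (d * G'.1.card + 1) + M.wt r = M.wt e + 1 := by
        rw [hr, wt_add, wt_add, wt_single]; ring
      rw [h3, h4] at h2
      rw [h1]
      refine Submodule.neg_mem _ ?_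
      refine (Submodule.span_le.2 ?_) h2
      rintro _ ⟨f, ⟨hf1, hf2⟩, rfl⟩
      exact ih f hf1 (by omega)
    · push Not at hch
      obtain ⟨F, F', h1, h2, h3, h4⟩ := hch
      have hF := hfl F h1
      have hF' := hfl F' h2
      have hle : Finsupp.single (⟨F, hF⟩ : FlatVar M) 1 + Finsupp.single (⟨F', hF'⟩ : FlatVar M) 1 ≤ e := by
        intro H
        rw [Finsupp.add_apply, Finsupp.single_apply, Finsupp.single_apply]
        rw [ext, dif_pos hF] at h1
        rw [ext, dif_pos hF'] at h2
        split_ifs with h5 h6 h6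
        · exact absurd (congrArg Subtype.val (h5.trans h6.symm)) (fun h => h3 h.le)
        · subst h5; omega
        · subst h6; omega
        · exact Nat.zero_le _
      obtain ⟨r, hr⟩ := exists_add_of_le hle
      have : M.cm e = 0 := by
        rw [hr, cm_add, cm_add]
        have := M.cy_mul_zero ⟨F, hF⟩ ⟨F', hF'⟩ h3 h4
        rw [cy, cy] at this
        rw [this, zero_mul]
      rw [this]
      exact Submodule.zero_mem _

theorem comp_le_span (k : ℕ) : chowComp M k ≤
    Submodule.span ℤ (Set.range fun m : M.FYk k => chowMk M (FYpoly M m.1)) := by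
  rintro _ ⟨p, hp, rfl⟩
  have hp' : p.IsHomogeneous k := hp
  rw [AlgHom.toLinearMap_apply, p.as_sum, map_sum]
  refine Submodule.sum_mem _ (fun e he => ?_)
  have hd : e.degree = k := by
    have := hp' (MvPolynomial.mem_support_iff.1 he)
    rw [Finsupp.degree_eq_weight_one]
    exact this
  have : MvPolynomial.monomial e (p.coeff e) = p.coeff e • MvPolynomial.monomial e (1 : ℤ) := by
    rw [MvPolynomial.smul_monomial]; simp
  rw [this, map_smul]
  exact Submodule.smul_mem _ _ (M.cm_mem_span k (k * Fintype.card E + 1) e hd (by omega))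

theorem FY_mem_comp (k : ℕ) (m : M.FYk k) : chowMk M (FYpoly M m.1) ∈ chowComp M k := by
  refine Submodule.mem_map_of_mem (f := (chowMk M).toLinearMap) ?_
  rw [MvPolynomial.mem_homogeneousSubmodule, FYpoly]
  apply MvPolynomial.isHomogeneous_monomial
  refine Eq.trans ?_ m.2.2
  rw [← M.deg_ext]
  congr 1
  funext F
  by_cases h : F ∈ M.flats ∧ F ≠ ∅
  · simp [ext, h]
  · rw [ext, dif_neg h]
    by_contra hc
    exact h (m.2.1.1 F (Ne.symm hc))

end spanning

section action
variable {E : Type*} [Fintype E] [DecidableEq E] {M : SimpleFlatMatroid E}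

theorem image_inv (g : Equiv.Perm E) (F : Finset E) : (F.image g).image (g⁻¹ : Equiv.Perm E) = F := by
  rw [Finset.image_image]
  ext x
  simp

theorem image_inv' (g : Equiv.Perm E) (F : Finset E) : (F.image (g⁻¹ : Equiv.Perm E)).image g = F := by
  rw [Finset.image_image]
  ext x
  simp

theorem IsAut.inv {g : Equiv.Perm E} (hg : M.IsAut g) : M.IsAut g⁻¹ := by
  have h1 : M.flats.image (fun F => F.image g) = M.flats := by
    apply Finset.eq_of_subset_of_card_le
    · intro F hF
      obtain ⟨K, hK, rfl⟩ := Finset.mem_image.1 hF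
      exact hg K hK
    · rw [Finset.card_image_of_injective]
      exact Finset.image_injective g.injective
  intro F hF
  rw [← h1] at hF
  obtain ⟨K, hK, rfl⟩ := Finset.mem_image.1 hF
  rw [image_inv]; exact hK

theorem image_ssubset (g : Equiv.Perm E) {F K : Finset E} : F.image g ⊂ K.image g ↔ F ⊂ K :=
  Finset.image_ssubset_image g.injective

theorem IsAut.rk_image {g : Equiv.Perm E} (hg : M.IsAut g) (n : ℕ) : ∀ F ∈ M.flats, F.card = n →
    M.rk (F.image g) = M.rk F := by
  induction n using Nat.strong_induction_on with
  | _ n ih =>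
    intro F hF hn
    by_cases h0 : F = ∅
    · subst h0; simp
    obtain ⟨K, hK, hmax⟩ := Finset.exists_max_image (M.flats.filter (fun K => K ⊂ F)) Finset.card
      ⟨∅, by simp [M.empty_mem, Finset.nonempty_iff_ne_empty.2 h0]⟩
    rw [Finset.mem_filter] at hK
    have hc : ¬ ∃ F'' ∈ M.flats, K ⊂ F'' ∧ F'' ⊂ F := by
      rintro ⟨L, hL, h1, h2⟩
      have := hmax L (Finset.mem_filter.2 ⟨hL, h2⟩)
      have := Finset.card_lt_card h1
      omega
    rw [M.rk_cover K hK.1 F hF hK.2 hc, M.rk_cover (K.image g) (hg _ hK.1) (F.image g) (hg _ hF)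
      ((image_ssubset g).2 hK.2), ih K.card (hn ▸ Finset.card_lt_card hK.2) K hK.1 rfl]
    rintro ⟨L, hL, h1, h2⟩
    refine hc ⟨L.image (g⁻¹ : Equiv.Perm E), hg.inv L hL, ?_, ?_⟩
    · rw [← image_ssubset g, image_inv']; exact h1
    · rw [← image_ssubset g, image_inv']; exact h2

theorem prevFlat_mact (g : Equiv.Perm E) (m : Finset E → ℕ) (F : Finset E) :
    prevFlat (mact g m) (F.image g) = (prevFlat m F).image g := by
  ext x
  simp only [prevFlat, Finset.mem_sup, Finset.mem_univ, true_and, Finset.mem_image]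
  constructor
  · rintro ⟨K, hK⟩
    split_ifs at hK with h
    · refine ⟨(g⁻¹ : Equiv.Perm E) x, ⟨K.image (g⁻¹ : Equiv.Perm E), ?_⟩, by simp⟩
      rw [if_pos]
      · exact Finset.mem_image_of_mem _ hK
      · refine ⟨h.1, ?_⟩
        rw [← image_ssubset g, image_inv']; exact h.2
    · simp at hK
  · rintro ⟨y, ⟨K, hK⟩, rfl⟩
    split_ifs at hK with h
    · refine ⟨K.image g, ?_⟩
      rw [if_pos]
      · exact Finset.mem_image_of_mem _ hK
      · refine ⟨?_, (image_ssubset g).2 h.2⟩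
        rw [mact, image_inv]; exact h.1
    · simp at hK

theorem deg_mact (g : Equiv.Perm E) (m : Finset E → ℕ) : deg (mact g m) = deg m := by
  unfold deg mact
  exact Fintype.sum_bijective (fun F : Finset E => F.image (g⁻¹ : Equiv.Perm E))
    ⟨Finset.image_injective (Equiv.injective _), fun F => ⟨F.image g, image_inv g F⟩⟩ _ _
    (fun _ => rfl)

theorem IsFY.mact {g : Equiv.Perm E} (hg : M.IsAut g) {m : Finset E → ℕ} (hm : M.IsFY m) :
    M.IsFY (mact g m) := by
  have key : ∀ P : Finset E → Prop, (∀ F, m F ≠ 0 → P (F.image g)) →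
      ∀ F, SimpleFlatMatroid.mact g m F ≠ 0 → P F := by
    intro P h F hF
    have := h _ hF
    rwa [image_inv'] at this
  have hmg : ∀ F, SimpleFlatMatroid.mact g m (F.image g) = m F := by
    intro F; rw [SimpleFlatMatroid.mact, image_inv]
  refine ⟨key _ ?_, ?_, key _ ?_⟩
  · intro F hF
    exact ⟨hg _ (hm.1 F hF).1, by simpa [Finset.image_eq_empty] using (hm.1 F hF).2⟩
  · intro F F' h h'
    rcases hm.2.1 _ _ h h' with h1 | h1
    · left
      have := Finset.image_subset_image (f := g) h1
      rwa [image_inv', image_inv'] at this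
    · right
      have := Finset.image_subset_image (f := g) h1
      rwa [image_inv', image_inv'] at this
  · intro F hF
    rw [hmg, prevFlat_mact, hg.rk_image _ F (hm.1 F hF).1 rfl,
      hg.rk_image _ _ (hm.prev_flat (hm.1 F hF).2) rfl]
    exact hm.2.2 F hF

theorem autRename_FYpoly {g : Equiv.Perm E} (hg : M.IsAut g) (m : Finset E → ℕ) :
    autRename M g hg (FYpoly M m) = FYpoly M (mact g m) := by
  rw [autRename, FYpoly, FYpoly, MvPolynomial.rename_monomial]
  refine congrArg (fun e => MvPolynomial.monomial e (1 : ℤ)) (Finsupp.ext (fun F => ?_))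
  have hF' : F.1.image (g⁻¹ : Equiv.Perm E) ∈ M.flats ∧ F.1.image (g⁻¹ : Equiv.Perm E) ≠ ∅ :=
    ⟨hg.inv _ F.2.1, by simpa [Finset.image_eq_empty] using F.2.2⟩
  have hinj : Function.Injective (fun F : FlatVar M =>
    (⟨F.1.image g, hg F.1 F.2.1, by
        simpa [Finset.image_eq_empty] using F.2.2⟩ : FlatVar M)) := by
    intro A B h
    exact Subtype.ext (Finset.image_injective g.injective (congrArg Subtype.val h))
  have hF : F = (fun F : FlatVar M =>
    (⟨F.1.image g, hg F.1 F.2.1, by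
        simpa [Finset.image_eq_empty] using F.2.2⟩ : FlatVar M)) ⟨_, hF'⟩ :=
    Subtype.ext (image_inv' g F.1).symm
  conv_lhs => rw [hF]
  rw [Finsupp.mapDomain_apply hinj]
  simp [mact]

end action

end SimpleFlatMatroid

open SimpleFlatMatroid in
/-- For a finite simple matroid `M` with automorphism group `G`: every automorphism sends
FY-monomials to FY-monomials of the same degree (so `G` permutes each `FY^k`), and for each
`k` the `ℤ`-linear isomorphism from the permutation module `ℤ[FY^k]` to `A^k` sending each
FY-monomial to its image in the Chow ring is `G`-equivariant. -/
theorem chow_component_is_permutation_module {E : Type*} [Fintype E] [DecidableEq E]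
    (M : SimpleFlatMatroid E) :
    (∀ (g : Equiv.Perm E), M.IsAut g → ∀ m : Finset E → ℕ, M.IsFY m →
        M.IsFY (mact g m) ∧ deg (mact g m) = deg m) ∧
    (∀ k : ℕ, ∃ φ : (M.FYk k →₀ ℤ) ≃ₗ[ℤ] chowComp M k,
        (∀ m : M.FYk k,
            ((φ (Finsupp.single m 1) : chowComp M k) : ChowRing M)
              = chowMk M (FYpoly M m.1)) ∧
        (∀ (g : Equiv.Perm E) (hg : M.IsAut g) (m m' : M.FYk k),
            (m' : Finset E → ℕ) = mact g (m : Finset E → ℕ) →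
            ((φ (Finsupp.single m' 1) : chowComp M k) : ChowRing M)
              = chowMk M (autRename M g hg (FYpoly M m.1)))) := by
  refine ⟨fun g hg m hm => ⟨hm.mact hg, deg_mact g m⟩, fun k => ?_⟩
  have hrange : Submodule.span ℤ (Set.range fun m : M.FYk k => chowMk M (FYpoly M m.1)) =
      chowComp M k := by
    apply le_antisymm
    · rw [Submodule.span_le]
      rintro _ ⟨m, rfl⟩
      exact FY_mem_comp M k m
    · exact comp_le_span M k
  have hli := lin_indep (M := M) k
  let φ := ((Module.Basis.span hli).repr.symm).trans (LinearEquiv.ofEq _ _ hrange)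
  have hφ : ∀ m : M.FYk k, ((φ (Finsupp.single m 1) : chowComp M k) : ChowRing M)
      = chowMk M (FYpoly M m.1) := by
    intro m
    simp only [φ, LinearEquiv.trans_apply, Module.Basis.repr_symm_single_one,
      LinearEquiv.coe_ofEq_apply]
    exact congrArg Subtype.val (Module.Basis.span_apply hli m)
  refine ⟨φ, hφ, fun g hg m m' h => ?_⟩
  rw [hφ, autRename_FYpoly, h]
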